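/- arXiv:2507.11881 — 2 statements merged into one kernel-verified Lean document; each statement's English description precedes it below -/
import Mathlib

section
/- Let δ > 0, s ∈ ℝ, and 1 ≤ p, r ≤ ∞, and let ω = (ω_k)_{k ≥ −1} ∈ AF(δ). There exists a constant C > 0, depending only on δ, s, p, r and the cutoff pair (χ, φ) but not on ω, such that for all complex-valued Schwartz functions f, g on ℝ³ one has ∥T_f g∥_{B^s_{p,r}(ω)} ≤ C ∥f∥_{L^∞} ∥∇g∥_{B^{s−1}_{p,r}(ω)}, where ∥∇g∥_{B^{s−1}_{p,r}(ω)} denotes the ℓ^r norm over k ≥ −1 of (ω_k 2^{k(s−1)} (Σ_{j=1}^3 ∥Δ_k ∂_j g∥_{L^p}²)^{1/2}). -/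
open MeasureTheory SchwartzMap Real
open scoped FourierTransform ENNReal NNReal

noncomputable section

/-- `ℝ³` as a Euclidean space. -/
abbrev E3 : Type := EuclideanSpace ℝ (Fin 3)

/-- A Littlewood–Paley cutoff pair `(χ, φ)`: smooth functions with
`supp χ ⊆ {|ξ| ≤ 4/3}`, `supp φ ⊆ {3/4 ≤ |ξ| ≤ 8/3}` and
`χ(ξ) + Σ_{k ≥ 0} φ(2^{-k} ξ) = 1` for all `ξ`. -/
structure LPCutoff where
  χ : E3 → ℝ
  φ : E3 → ℝ
  smooth_χ : ContDiff ℝ (⊤ : ℕ∞) χ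
  smooth_φ : ContDiff ℝ (⊤ : ℕ∞) φ
  supp_χ : ∀ ξ : E3, 4 / 3 < ‖ξ‖ → χ ξ = 0
  supp_φ : ∀ ξ : E3, ‖ξ‖ < 3 / 4 ∨ 8 / 3 < ‖ξ‖ → φ ξ = 0
  partition : ∀ ξ : E3, χ ξ + ∑' k : ℕ, φ ((2 : ℝ) ^ (-(k : ℤ)) • ξ) = 1

/-- The Littlewood–Paley block `Δ_k f`, indexed by `n : ℕ` corresponding to `k = n - 1 ≥ -1`
(blocks with `k ≤ -2` vanish):
`Δ_{-1} f = 𝓕⁻¹(χ 𝓕f)` and `Δ_k f = 𝓕⁻¹(φ(2^{-k}·) 𝓕f)` for `k ≥ 0`. -/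
def LPblock (P : LPCutoff) (n : ℕ) (f : E3 → ℂ) : E3 → ℂ :=
  if n = 0 then 𝓕⁻ (fun ξ => (P.χ ξ : ℂ) * 𝓕 f ξ)
  else 𝓕⁻ (fun ξ => (P.φ ((2 : ℝ) ^ (-((n : ℤ) - 1)) • ξ) : ℂ) * 𝓕 f ξ)

/-- `LPlow P j f = Σ_{n < j} Δ^{(n)} f`, i.e. the low-frequency cutoff `S_{j-1} f`
in the paper's indexing (so `S_j f = LPlow P (j+1) f`). -/
def LPlow (P : LPCutoff) (j : ℕ) (f : E3 → ℂ) : E3 → ℂ :=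
  fun x => ∑ n ∈ Finset.range j, LPblock P n f x

/-- Bony's paraproduct `T_f g = Σ_l S_{l-1} f · Δ_l g` (the terms with `l ≤ 0` vanish). -/
def paraproduct (P : LPCutoff) (f g : E3 → ℂ) : E3 → ℂ :=
  fun x => ∑' l : ℕ, LPlow P (l + 1) f x * LPblock P (l + 2) g x

/-- Bony's remainder `R(f,g) = Σ_l Δ_l f · (Δ_{l-1} + Δ_l + Δ_{l+1}) g`
(the terms with `l ≤ -2` vanish). -/
def lpRemainder (P : LPCutoff) (f g : E3 → ℂ) : E3 → ℂ :=
  fun x => ∑' n : ℕ, LPblock P n f x *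
    ((if n = 0 then 0 else LPblock P (n - 1) g x) +
      LPblock P n g x + LPblock P (n + 1) g x)

/-- The weighted Besov norm `∥f∥_{B^s_{p,r}(ω)}`: the `ℓ^r` norm (over `k = n - 1 ≥ -1`)
of `(ω_k 2^{ks} ∥Δ_k f∥_{L^p})`. -/
def besovW (P : LPCutoff) (ω : ℕ → ℝ) (s : ℝ) (p r : ℝ≥0∞) (f : E3 → ℂ) : ℝ≥0∞ :=
  eLpNorm (fun n : ℕ =>
    ω n * (2 : ℝ) ^ (((n : ℝ) - 1) * s) * (eLpNorm (LPblock P n f) p volume).toReal)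
    r (Measure.count : Measure ℕ)

/-- The (unweighted) Besov norm `∥f∥_{B^s_{p,r}}`. -/
def besov (P : LPCutoff) (s : ℝ) (p r : ℝ≥0∞) (f : E3 → ℂ) : ℝ≥0∞ :=
  besovW P (fun _ => 1) s p r f

/-- The `j`-th partial derivative of a complex-valued function on `ℝ³`. -/
def pdC (j : Fin 3) (f : E3 → ℂ) : E3 → ℂ :=
  fun x => fderiv ℝ f x (EuclideanSpace.single j 1)

/-- The weighted Besov norm of a gradient, `∥∇g∥_{B^s_{p,r}(ω)}`: the `ℓ^r` norm over
`k = n - 1 ≥ -1` of `(ω_k 2^{ks} (Σ_j ∥Δ_k ∂_j g∥_{L^p}²)^{1/2})`. -/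
def gradBesovW (P : LPCutoff) (ω : ℕ → ℝ) (s : ℝ) (p r : ℝ≥0∞) (g : E3 → ℂ) : ℝ≥0∞ :=
  eLpNorm (fun n : ℕ =>
    ω n * (2 : ℝ) ^ (((n : ℝ) - 1) * s) *
      (∑ j : Fin 3, ((eLpNorm (LPblock P n (pdC j g)) p volume).toReal) ^ 2) ^ ((1 : ℝ) / 2))
    r (Measure.count : Measure ℕ)

/-- An acceptable frequency weight of parameter `δ`:
`1 ≤ ω_k ≤ ω_{k+1} ≤ 2^δ ω_k` for all `k ≥ -1`. -/
def AFweight (δ : ℝ) (ω : ℕ → ℝ) : Prop :=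
  ∀ k : ℕ, 1 ≤ ω k ∧ ω k ≤ ω (k + 1) ∧ ω (k + 1) ≤ (2 : ℝ) ^ δ * ω k

/-- **Young's inequality** `L¹ ⋆ Lᵖ ⊆ Lᵖ`, in terms of the absolute values of continuous functions. -/
theorem eLpNorm_le_of_enorm_le_lintegral {K f h : E3 → ℂ} (hK : Continuous K) (hf : Continuous f)
    {p : ℝ≥0∞} (hp : 1 ≤ p) (hK1 : eLpNorm K 1 volume ≠ ⊤)
    (hh : ∀ x, ‖h x‖ₑ ≤ ∫⁻ y, ‖K y‖ₑ * ‖f (x - y)‖ₑ) :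
    eLpNorm h p volume ≤ eLpNorm K 1 volume * eLpNorm f p volume := by
  have hKm : Measurable fun y => ‖K y‖ₑ := hK.enorm.measurable
  set ν : Measure E3 := volume.withDensity fun y => ‖K y‖ₑ with hν
  have hA : ν Set.univ = eLpNorm K 1 volume := by
    rw [eLpNorm_one_eq_lintegral_enorm, hν, withDensity_apply _ .univ, Measure.restrict_univ]
  set A := eLpNorm K 1 volume with hAdef
  have hfx : ∀ x, Continuous fun y => f (x - y) := fun x => by fun_prop
  have h_translate : ∀ x, ∫⁻ y, ‖K y‖ₑ * ‖f (x - y)‖ₑ = eLpNorm (fun y => f (x - y)) 1 ν := by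
    intro x
    rw [eLpNorm_one_eq_lintegral_enorm, hν,
      lintegral_withDensity_eq_lintegral_mul _ hKm (hfx x).enorm.measurable]
    rfl
  have hb : ∀ x, ‖h x‖ₑ ≤ eLpNorm (fun y => f (x - y)) p ν * A ^ (1 - 1 / p.toReal) := by
    intro x
    refine (hh x).trans ((h_translate x).le.trans ?_)
    simpa [hA] using eLpNorm_le_eLpNorm_mul_rpow_measure_univ (μ := ν) hp
      (hfx x).aestronglyMeasurable
  by_cases hpt : p = ⊤
  · subst hpt
    rw [eLpNorm_exponent_top (f := h)]
    refine eLpNormEssSup_le_of_ae_enorm_bound (.of_forall fun x => (hb x).trans ?_)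
    simp only [ENNReal.toReal_top, div_zero, sub_zero, ENNReal.rpow_one]
    rw [mul_comm]
    gcongr
    have hmp : MeasurePreserving (fun y : E3 => x - y) volume volume :=
      Measure.measurePreserving_sub_left volume x
    calc eLpNorm (fun y => f (x - y)) ⊤ ν ≤ eLpNorm (fun y => f (x - y)) ⊤ volume := by
          simp only [eLpNorm_exponent_top]
          exact eLpNormEssSup_mono_measure _ (withDensity_absolutelyContinuous _ _)
      _ = eLpNorm f ⊤ volume :=
          eLpNorm_comp_measurePreserving hf.aestronglyMeasurable hmp
  have hp0 : p ≠ 0 := (zero_lt_one.trans_le hp).ne'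
  have hq : 1 ≤ p.toReal := by
    rw [← ENNReal.toReal_one]; exact ENNReal.toReal_mono hpt hp
  set q := p.toReal with hqdef
  have hq0 : 0 < q := by linarith
  have hfin : IsFiniteMeasure ν := ⟨by rw [hA]; exact hK1.lt_top⟩
  have key : ∫⁻ x, ‖h x‖ₑ ^ q ≤ A ^ q * ∫⁻ x, ‖f x‖ₑ ^ q := by
    calc ∫⁻ x, ‖h x‖ₑ ^ q
        ≤ ∫⁻ x, (∫⁻ y, ‖f (x - y)‖ₑ ^ q ∂ν) * A ^ (q - 1) := by
          refine lintegral_mono fun x => ?_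
          refine (ENNReal.rpow_le_rpow (hb x) hq0.le).trans_eq ?_
          rw [ENNReal.mul_rpow_of_nonneg _ _ hq0.le, ← ENNReal.rpow_mul,
            eLpNorm_eq_lintegral_rpow_enorm_toReal hp0 hpt, ← ENNReal.rpow_mul]
          congr 2
          · rw [← hqdef, one_div_mul_cancel hq0.ne', ENNReal.rpow_one]
          · field_simp
      _ = (∫⁻ x, ∫⁻ y, ‖f (x - y)‖ₑ ^ q ∂ν) * A ^ (q - 1) := by
          rw [lintegral_mul_const']
          exact ENNReal.rpow_ne_top_of_nonneg (by linarith) hK1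
      _ = (∫⁻ y, (∫⁻ x, ‖f (x - y)‖ₑ ^ q) ∂ν) * A ^ (q - 1) := by
          congr 1
          refine lintegral_lintegral_swap ?_
          exact Measurable.aemeasurable
            (((hf.comp (continuous_fst.sub continuous_snd)).enorm.measurable).pow_const q)
      _ = A ^ q * ∫⁻ x, ‖f x‖ₑ ^ q := by
          have : ∀ y, ∫⁻ x, ‖f (x - y)‖ₑ ^ q = ∫⁻ x, ‖f x‖ₑ ^ q := fun y =>
            lintegral_sub_right_eq_self (fun x => ‖f x‖ₑ ^ q) y
          simp_rw [this]
          rw [lintegral_const, hA, mul_assoc, mul_comm]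
          congr 1
          nth_rewrite 1 [← ENNReal.rpow_one A]
          rw [← ENNReal.rpow_add_of_nonneg _ _ zero_le_one (by linarith)]
          congr 1; ring
  rw [eLpNorm_eq_lintegral_rpow_enorm_toReal hp0 hpt, eLpNorm_eq_lintegral_rpow_enorm_toReal hp0 hpt,
    ← hqdef]
  refine (ENNReal.rpow_le_rpow key (by positivity)).trans_eq ?_
  rw [ENNReal.mul_rpow_of_nonneg _ _ (by positivity), ← ENNReal.rpow_mul,
    mul_one_div_cancel hq0.ne', ENNReal.rpow_one]

/-- The Fourier multiplier operator `f ↦ 𝓕⁻¹(m · 𝓕f)` on Schwartz functions. -/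
def fmul (m f : 𝓢(E3, ℂ)) : 𝓢(E3, ℂ) :=
  SchwartzMap.convolution (ContinuousLinearMap.mul ℂ ℂ) (𝓕⁻ m) f

theorem fourier_fmul (m f : 𝓢(E3, ℂ)) (ξ : E3) : 𝓕 (fmul m f) ξ = m ξ * 𝓕 f ξ := by
  simp [fmul, SchwartzMap.fourier_convolution]

theorem fmul_eq_fourierInv (m f : 𝓢(E3, ℂ)) :
    ⇑(fmul m f) = 𝓕⁻ (fun ξ => m ξ * 𝓕 (⇑f) ξ) := by
  have h : (fun ξ => m ξ * 𝓕 (⇑f) ξ) = ⇑((𝓕 (fmul m f) : 𝓢(E3, ℂ))) := by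
    ext ξ
    rw [fourier_fmul, SchwartzMap.fourier_coe]
  rw [h, ← SchwartzMap.fourierInv_coe]
  simp

theorem schwartz_ext_fourier {f g : 𝓢(E3, ℂ)} (h : ∀ ξ, 𝓕 f ξ = 𝓕 g ξ) : f = g := by
  have h' : 𝓕 f = 𝓕 g := by ext ξ; exact h ξ
  simpa using congrArg (fun u : 𝓢(E3, ℂ) => 𝓕⁻ u) h'

theorem eLpNorm_fmul_le (m f : 𝓢(E3, ℂ)) {p : ℝ≥0∞} (hp : 1 ≤ p) :
    eLpNorm (fmul m f) p volume ≤ eLpNorm (𝓕⁻ m : 𝓢(E3, ℂ)) 1 volume * eLpNorm f p volume := by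
  refine eLpNorm_le_of_enorm_le_lintegral (SchwartzMap.continuous _) f.continuous hp
    (SchwartzMap.eLpNorm_lt_top _ _ _).ne fun x => ?_
  rw [fmul, SchwartzMap.convolution_apply, convolution_def]
  refine (enorm_integral_le_lintegral_enorm _).trans_eq ?_
  simp [enorm_mul]

/-- The dilation `m(c ·)` of a Schwartz function. -/
def dilate (c : ℝ) (hc : c ≠ 0) (m : 𝓢(E3, ℂ)) : 𝓢(E3, ℂ) :=
  SchwartzMap.compCLMOfContinuousLinearEquiv ℂ
    (ContinuousLinearEquiv.smulLeft (Units.mk0 c hc)) m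

theorem dilate_apply {c : ℝ} (hc : c ≠ 0) (m : 𝓢(E3, ℂ)) (ξ : E3) :
    dilate c hc m ξ = m (c • ξ) := rfl

theorem fourierInv_dilate {c : ℝ} (hc : c ≠ 0) (m : 𝓢(E3, ℂ)) (x : E3) :
    (𝓕⁻ (dilate c hc m) : 𝓢(E3, ℂ)) x = |(c ^ 3)⁻¹| • (𝓕⁻ m : 𝓢(E3, ℂ)) (c⁻¹ • x) := by
  simp only [SchwartzMap.fourierInv_coe, Real.fourierInv_eq]
  have := Measure.integral_comp_smul (volume : Measure E3)
    (fun v => 𝐞 (inner ℝ v (c⁻¹ • x)) • m v) c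
  rw [finrank_euclideanSpace_fin] at this
  rw [← this]
  congr 1
  ext v
  rw [dilate_apply, real_inner_smul_left, real_inner_smul_right]
  rw [mul_inv_cancel_left₀ hc]

theorem eLpNorm_one_fourierInv_dilate {c : ℝ} (hc : c ≠ 0) (m : 𝓢(E3, ℂ)) :
    eLpNorm (𝓕⁻ (dilate c hc m) : 𝓢(E3, ℂ)) 1 volume =
      eLpNorm (𝓕⁻ m : 𝓢(E3, ℂ)) 1 volume := by
  have h : ⇑(𝓕⁻ (dilate c hc m) : 𝓢(E3, ℂ)) =
      |(c ^ 3)⁻¹| • (fun x => (𝓕⁻ m : 𝓢(E3, ℂ)) (c⁻¹ • x)) := by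
    ext x; exact fourierInv_dilate hc m x
  rw [h, eLpNorm_const_smul, eLpNorm_one_eq_lintegral_enorm, eLpNorm_one_eq_lintegral_enorm]
  have hm : Measurable fun x : E3 => c⁻¹ • x := measurable_const_smul _
  rw [← lintegral_map (f := fun y => ‖(𝓕⁻ m : 𝓢(E3, ℂ)) y‖ₑ) (g := fun x : E3 => c⁻¹ • x)
    (SchwartzMap.continuous _).enorm.measurable hm,
    Measure.map_addHaar_smul _ (inv_ne_zero hc), lintegral_smul_measure,
    finrank_euclideanSpace_fin, smul_eq_mul, ← mul_assoc]
  have : ‖|(c ^ 3)⁻¹|‖ₑ * ENNReal.ofReal |((c⁻¹) ^ 3)⁻¹| = 1 := by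
    rw [Real.enorm_of_nonneg (abs_nonneg _), ← ENNReal.ofReal_mul (abs_nonneg _), ← abs_mul]
    have : (c ^ 3)⁻¹ * ((c⁻¹) ^ 3)⁻¹ = 1 := by field_simp
    rw [this, abs_one, ENNReal.ofReal_one]
  rw [this, one_mul]

theorem eLpNorm_fmul_dilate_le {c : ℝ} (hc : c ≠ 0) (m f : 𝓢(E3, ℂ)) {p : ℝ≥0∞} (hp : 1 ≤ p) :
    eLpNorm (fmul (dilate c hc m) f) p volume ≤
      eLpNorm (𝓕⁻ m : 𝓢(E3, ℂ)) 1 volume * eLpNorm f p volume := by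
  rw [← eLpNorm_one_fourierInv_dilate hc m]
  exact eLpNorm_fmul_le _ f hp

/-- The pointwise product of two Schwartz functions. -/
def mulS (u v : 𝓢(E3, ℂ)) : 𝓢(E3, ℂ) := SchwartzMap.pairing (ContinuousLinearMap.mul ℂ ℂ) u v

theorem mulS_apply (u v : 𝓢(E3, ℂ)) (x : E3) : mulS u v x = u x * v x := rfl

theorem fourier_fourier_apply (u : 𝓢(E3, ℂ)) (x : E3) : 𝓕 (𝓕 u) x = u (-x) := by
  have h : (𝓕⁻ (𝓕 u) : 𝓢(E3, ℂ)) (-x) = u (-x) := by simp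
  rw [SchwartzMap.fourierInv_coe, Real.fourierInv_eq_fourier_neg, neg_neg,
    ← SchwartzMap.fourier_coe] at h
  exact h

theorem fourier_mulS (u v : 𝓢(E3, ℂ)) (ξ : E3) :
    𝓕 (mulS u v) ξ = ∫ η, 𝓕 u η * 𝓕 v (ξ - η) := by
  have h : 𝓕 (mulS u v) = SchwartzMap.convolution (ContinuousLinearMap.mul ℂ ℂ) (𝓕 u) (𝓕 v) := by
    refine schwartz_ext_fourier fun x => ?_
    rw [SchwartzMap.fourier_convolution, SchwartzMap.pairing_apply_apply]
    simp [fourier_fourier_apply, mulS_apply]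
  rw [h, SchwartzMap.convolution_apply, convolution_def]
  rfl

theorem eLpNorm_mulS_le (u v : 𝓢(E3, ℂ)) (p : ℝ≥0∞) :
    eLpNorm (mulS u v) p volume ≤ eLpNorm u ⊤ volume * eLpNorm v p volume := by
  have h : ⇑(mulS u v) = ⇑u • ⇑v := rfl
  rw [h]
  exact eLpNorm_smul_le_eLpNorm_top_mul_eLpNorm p v.continuous.aestronglyMeasurable ⇑u

theorem hasCompactSupport_ofReal {h : E3 → ℝ} {R : ℝ} (hs : ∀ ξ, R < ‖ξ‖ → h ξ = 0) :
    HasCompactSupport fun ξ => (h ξ : ℂ) := by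
  refine HasCompactSupport.intro (isCompact_closedBall (0 : E3) R) fun ξ hξ => ?_
  rw [Metric.mem_closedBall, dist_zero_right, not_le] at hξ
  simp [hs ξ hξ]

namespace LPCutoff

variable (P : LPCutoff)

/-- The low-frequency cutoff `χ` as a Schwartz function. -/
def lowSymbol : 𝓢(E3, ℂ) :=
  (hasCompactSupport_ofReal P.supp_χ).toSchwartzMap (Complex.ofRealCLM.contDiff.comp P.smooth_χ)

/-- The annular cutoff `φ` as a Schwartz function. -/
def annulusSymbol : 𝓢(E3, ℂ) :=
  (hasCompactSupport_ofReal fun ξ h => P.supp_φ ξ (Or.inr h)).toSchwartzMap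
    (Complex.ofRealCLM.contDiff.comp P.smooth_φ)

theorem lowSymbol_apply (ξ : E3) : P.lowSymbol ξ = P.χ ξ := rfl

theorem annulusSymbol_apply (ξ : E3) : P.annulusSymbol ξ = P.φ ξ := rfl

end LPCutoff

theorem two_zpow_ne_zero (k : ℤ) : (2 : ℝ) ^ k ≠ 0 := zpow_ne_zero _ two_ne_zero

/-- The symbol of the `n`-th Littlewood–Paley block. -/
def LPCutoff.blockSymbol (P : LPCutoff) : ℕ → 𝓢(E3, ℂ)
  | 0 => P.lowSymbol
  | m + 1 => dilate ((2 : ℝ) ^ (-(m : ℤ))) (two_zpow_ne_zero _) P.annulusSymbol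

theorem LPblock_eq_fourierInv (P : LPCutoff) (n : ℕ) (F : E3 → ℂ) :
    LPblock P n F = 𝓕⁻ (fun ξ => P.blockSymbol n ξ * 𝓕 F ξ) := by
  cases n with
  | zero => rfl
  | succ m =>
    simp only [LPblock, Nat.succ_ne_zero, if_false, LPCutoff.blockSymbol, dilate_apply,
      LPCutoff.annulusSymbol_apply]
    simp

theorem LPblock_eq_fmul (P : LPCutoff) (n : ℕ) (f : 𝓢(E3, ℂ)) :
    LPblock P n f = fmul (P.blockSymbol n) f := by
  rw [LPblock_eq_fourierInv, fmul_eq_fourierInv]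

theorem LPCutoff.summable_phi (P : LPCutoff) (ξ : E3) :
    Summable fun k : ℕ => P.φ ((2 : ℝ) ^ (-(k : ℤ)) • ξ) := by
  obtain ⟨N, hN⟩ := pow_unbounded_of_one_lt (2 * ‖ξ‖) (one_lt_two (α := ℝ))
  refine summable_of_ne_finset_zero (s := Finset.range N) fun k hk => P.supp_φ _ (Or.inl ?_)
  rw [Finset.mem_range, not_lt] at hk
  have h2 : (2 : ℝ) ^ N ≤ 2 ^ k := pow_le_pow_right₀ one_le_two hk
  have h3 : (0 : ℝ) < 2 ^ k := by positivity
  rw [norm_smul, zpow_neg, zpow_natCast, norm_inv, norm_pow, Real.norm_two,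
    inv_mul_lt_iff₀ h3]
  linarith

/-- Telescoping of the partition of unity. -/
theorem LPCutoff.low_sum (P : LPCutoff) (l : ℕ) (ξ : E3) :
    P.χ ξ + ∑ k ∈ Finset.range l, P.φ ((2 : ℝ) ^ (-(k : ℤ)) • ξ) =
      P.χ ((2 : ℝ) ^ (-(l : ℤ)) • ξ) := by
  have h1 := P.partition ξ
  have h2 := P.partition ((2 : ℝ) ^ (-(l : ℤ)) • ξ)
  rw [← (P.summable_phi ξ).sum_add_tsum_nat_add l] at h1
  have h3 : ∀ k : ℕ, (2 : ℝ) ^ (-(k : ℤ)) • (2 : ℝ) ^ (-(l : ℤ)) • ξ =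
      (2 : ℝ) ^ (-((k + l : ℕ) : ℤ)) • ξ := by
    intro k
    rw [smul_smul, ← zpow_add₀ two_ne_zero]
    congr 2
    push_cast; ring
  simp_rw [h3] at h2
  linarith

/-- `S_l f` as a Fourier multiplier. -/
theorem LPlow_eq_fmul (P : LPCutoff) (l : ℕ) (f : 𝓢(E3, ℂ)) :
    LPlow P (l + 1) f =
      fmul (dilate ((2 : ℝ) ^ (-(l : ℤ))) (two_zpow_ne_zero _) P.lowSymbol) f := by
  have h : fmul (dilate ((2 : ℝ) ^ (-(l : ℤ))) (two_zpow_ne_zero _) P.lowSymbol) f =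
      ∑ n ∈ Finset.range (l + 1), fmul (P.blockSymbol n) f := by
    refine schwartz_ext_fourier fun ξ => ?_
    have : 𝓕 (∑ n ∈ Finset.range (l + 1), fmul (P.blockSymbol n) f) =
        ∑ n ∈ Finset.range (l + 1), (𝓕 (fmul (P.blockSymbol n) f) : 𝓢(E3, ℂ)) :=
      map_sum (FourierTransform.fourierCLM ℂ 𝓢(E3, ℂ)) _ _
    rw [this, sum_apply]
    simp_rw [fourier_fmul]
    rw [← Finset.sum_mul, Finset.sum_range_succ', add_comm, dilate_apply, P.lowSymbol_apply,
      ← P.low_sum l ξ]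
    push_cast
    rfl
  rw [h]
  ext x
  simp only [LPlow, sum_apply, LPblock_eq_fmul]

/-- The Littlewood–Paley blocks are bounded on `Lᵖ`, uniformly in the frequency. -/
theorem eLpNorm_fmul_blockSymbol_le (P : LPCutoff) (n : ℕ) (f : 𝓢(E3, ℂ)) {p : ℝ≥0∞}
    (hp : 1 ≤ p) :
    eLpNorm (fmul (P.blockSymbol n) f) p volume ≤
      (eLpNorm (𝓕⁻ P.lowSymbol : 𝓢(E3, ℂ)) 1 volume +
        eLpNorm (𝓕⁻ P.annulusSymbol : 𝓢(E3, ℂ)) 1 volume) * eLpNorm f p volume := by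
  cases n with
  | zero =>
    refine (eLpNorm_fmul_le _ _ hp).trans ?_
    gcongr
    exact le_self_add
  | succ m =>
    refine (eLpNorm_fmul_dilate_le _ _ _ hp).trans ?_
    gcongr
    exact le_add_self

/-- The bump function equal to `1` on the annulus carrying `φ`. -/
def bigBump : ContDiffBump (0 : E3) := ⟨8 / 3, 3, by norm_num, by norm_num⟩

/-- A bump function at the origin supported away from the annulus carrying `φ`. -/
def smallBump : ContDiffBump (0 : E3) := ⟨1 / 2, 3 / 4, by norm_num, by norm_num⟩

theorem normSq_add_smallBump_pos (ξ : E3) : 0 < ‖ξ‖ ^ 2 + smallBump ξ := by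
  by_cases h : ξ = 0
  · subst h
    have : smallBump (0 : E3) = 1 :=
      smallBump.one_of_mem_closedBall (Metric.mem_closedBall_self (by norm_num [smallBump]))
    rw [this]; positivity
  · have : 0 < ‖ξ‖ := norm_pos_iff.mpr h
    have := smallBump.nonneg (x := ξ)
    positivity

/-- The real symbol `ξ_j / |ξ|²`, regularised away from the annulus carrying `φ`. -/
def rieszReal (j : Fin 3) (ξ : E3) : ℝ := bigBump ξ * ξ j / (‖ξ‖ ^ 2 + smallBump ξ)

theorem contDiff_rieszReal (j : Fin 3) : ContDiff ℝ (⊤ : ℕ∞) (rieszReal j) := by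
  unfold rieszReal
  refine ContDiff.div ?_ ?_ fun ξ => (normSq_add_smallBump_pos ξ).ne'
  · exact bigBump.contDiff.mul (by fun_prop)
  · exact (contDiff_norm_sq ℝ).add smallBump.contDiff

theorem rieszReal_eq_zero (j : Fin 3) (ξ : E3) (h : 3 < ‖ξ‖) : rieszReal j ξ = 0 := by
  have : bigBump ξ = 0 := bigBump.zero_of_le_dist (by rw [dist_zero_right]; exact h.le)
  simp [rieszReal, this]

theorem sum_rieszReal {ξ : E3} (h1 : 3 / 4 ≤ ‖ξ‖) (h2 : ‖ξ‖ ≤ 8 / 3) :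
    ∑ j, rieszReal j ξ * ξ j = 1 := by
  have hb : bigBump ξ = 1 := bigBump.one_of_mem_closedBall 
    (by rw [Metric.mem_closedBall, dist_zero_right]; exact h2)
  have hs : smallBump ξ = 0 := smallBump.zero_of_le_dist (by rw [dist_zero_right]; exact h1)
  have hn : ‖ξ‖ ^ 2 ≠ 0 := by
    have : 0 < ‖ξ‖ := by linarith
    positivity
  simp only [rieszReal, hb, hs, one_mul, add_zero]
  rw [show (∑ j, ξ j / ‖ξ‖ ^ 2 * ξ j) = (∑ j, ξ j ^ 2) / ‖ξ‖ ^ 2 by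
    rw [Finset.sum_div]; exact Finset.sum_congr rfl fun j _ => by ring]
  rw [← EuclideanSpace.real_norm_sq_eq, div_self hn]

/-- The symbol `ξ_j / (2πi|ξ|²)`, regularised away from the annulus carrying `φ`. -/
def rieszSymbol (j : Fin 3) : 𝓢(E3, ℂ) :=
  (2 * π * Complex.I)⁻¹ • (hasCompactSupport_ofReal (rieszReal_eq_zero j)).toSchwartzMap
    (Complex.ofRealCLM.contDiff.comp (contDiff_rieszReal j))

theorem rieszSymbol_apply (j : Fin 3) (ξ : E3) :
    rieszSymbol j ξ = (2 * π * Complex.I)⁻¹ * (rieszReal j ξ : ℂ) := rfl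

/-- The partial derivative of a Schwartz function, as a Schwartz function. -/
def pdS (j : Fin 3) (g : 𝓢(E3, ℂ)) : 𝓢(E3, ℂ) :=
  LineDeriv.lineDerivOp (EuclideanSpace.single j (1 : ℝ)) g

theorem coe_pdS (j : Fin 3) (g : 𝓢(E3, ℂ)) : ⇑(pdS j g) = pdC j g := by
  ext x
  exact SchwartzMap.lineDerivOp_apply_eq_fderiv _ _ _

theorem fourier_pdS (j : Fin 3) (g : 𝓢(E3, ℂ)) (ξ : E3) :
    𝓕 (pdS j g) ξ = 2 * π * Complex.I * (ξ j : ℂ) * 𝓕 g ξ := by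
  rw [pdS, SchwartzMap.fourier_lineDerivOp_eq, smul_apply,
    SchwartzMap.smulLeftCLM_apply_apply (by fun_prop)]
  simp [mul_assoc, EuclideanSpace.inner_single_right]

theorem fmul_blockSymbol_succ_eq (P : LPCutoff) (m : ℕ) (g : 𝓢(E3, ℂ)) :
    fmul (P.blockSymbol (m + 1)) g = ∑ j, ((2 : ℝ) ^ (-(m : ℤ))) •
      fmul (dilate ((2 : ℝ) ^ (-(m : ℤ))) (two_zpow_ne_zero _) (rieszSymbol j))
        (fmul (P.blockSymbol (m + 1)) (pdS j g)) := by
  set c := (2 : ℝ) ^ (-(m : ℤ)) with hc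
  refine schwartz_ext_fourier fun ξ => ?_
  have : 𝓕 (∑ j, c • fmul (dilate c (two_zpow_ne_zero _) (rieszSymbol j))
        (fmul (P.blockSymbol (m + 1)) (pdS j g))) =
      ∑ j, c • (𝓕 (fmul (dilate c (two_zpow_ne_zero _) (rieszSymbol j))
        (fmul (P.blockSymbol (m + 1)) (pdS j g))) : 𝓢(E3, ℂ)) := by
    refine (map_sum (FourierTransform.fourierCLM ℝ 𝓢(E3, ℂ)) _ _).trans ?_
    exact Finset.sum_congr rfl fun j _ => map_smul (FourierTransform.fourierCLM ℝ 𝓢(E3, ℂ)) _ _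
  rw [this, sum_apply]
  simp only [smul_apply, fourier_fmul, fourier_pdS, dilate_apply, rieszSymbol_apply,
    LPCutoff.blockSymbol, LPCutoff.annulusSymbol_apply, ← hc]
  by_cases h : P.φ (c • ξ) = 0
  · simp [h]
  have h12 : 3 / 4 ≤ ‖c • ξ‖ ∧ ‖c • ξ‖ ≤ 8 / 3 := by
    by_contra hcon
    refine h (P.supp_φ _ ?_)
    by_contra h'
    push Not at h'
    exact hcon h'
  have hsum := congrArg (fun t : ℝ => (t : ℂ)) (sum_rieszReal h12.1 h12.2)
  simp only [PiLp.smul_apply, smul_eq_mul] at hsum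
  push_cast at hsum
  have hpi : (2 * π * Complex.I : ℂ) ≠ 0 := by simp [Real.pi_ne_zero]
  calc (P.φ (c • ξ) : ℂ) * 𝓕 g ξ
      = (∑ j, (rieszReal j (c • ξ) : ℂ) * (c * ξ j)) * ((P.φ (c • ξ) : ℂ) * 𝓕 g ξ) := by
        rw [hsum, one_mul]
    _ = _ := by
        rw [Finset.sum_mul]
        refine Finset.sum_congr rfl fun j _ => ?_
        rw [Complex.real_smul]
        field_simp

/-- Bernstein's inequality: the dyadic blocks are controlled by the blocks of the gradient. -/
theorem eLpNorm_fmul_blockSymbol_succ_le (P : LPCutoff) (m : ℕ) (g : 𝓢(E3, ℂ)) {p : ℝ≥0∞}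
    (hp : 1 ≤ p) :
    eLpNorm (fmul (P.blockSymbol (m + 1)) g) p volume ≤ ENNReal.ofReal ((2 : ℝ) ^ (-(m : ℤ))) *
      ∑ j, eLpNorm (𝓕⁻ (rieszSymbol j) : 𝓢(E3, ℂ)) 1 volume *
        eLpNorm (fmul (P.blockSymbol (m + 1)) (pdS j g)) p volume := by
  rw [fmul_blockSymbol_succ_eq, Finset.mul_sum]
  have hcoe : ∀ F : Fin 3 → 𝓢(E3, ℂ), ⇑(∑ j, F j) = ∑ j, ⇑(F j) := fun F => by
    ext x; simp
  rw [hcoe]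
  refine (eLpNorm_sum_le (fun j _ => (SchwartzMap.continuous _).aestronglyMeasurable) hp).trans ?_
  refine Finset.sum_le_sum fun j _ => ?_
  have hsmul : ∀ (c : ℝ) (F : 𝓢(E3, ℂ)), ⇑(c • F) = c • ⇑F := fun _ _ => rfl
  rw [hsmul, eLpNorm_const_smul, Real.enorm_of_nonneg (by positivity)]
  gcongr
  exact eLpNorm_fmul_dilate_le _ _ _ hp

/-- The Fourier support of a product. -/
theorem fourier_mulS_eq_zero {u v : 𝓢(E3, ℂ)} {R a b : ℝ}
    (hu : ∀ η, R < ‖η‖ → 𝓕 u η = 0) (hv : ∀ η, ‖η‖ < a ∨ b < ‖η‖ → 𝓕 v η = 0) {ξ : E3}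
    (hξ : ‖ξ‖ < a - R ∨ b + R < ‖ξ‖) : 𝓕 (mulS u v) ξ = 0 := by
  rw [fourier_mulS]
  refine integral_eq_zero_of_ae (.of_forall fun η => ?_)
  by_cases h : R < ‖η‖
  · simp [hu η h]
  · have : 𝓕 v (ξ - η) = 0 := by
      refine hv _ ?_
      have h1 := norm_sub_norm_le ξ η
      have h2 := norm_sub_le ξ η
      rcases hξ with hξ | hξ
      · left; linarith
      · right; linarith
    simp [this]

/-- The `Lᵖ` norm of a Schwartz function, as a real number. -/
def lpn (p : ℝ≥0∞) (u : 𝓢(E3, ℂ)) : ℝ := (eLpNorm u p volume).toReal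

theorem lpn_nonneg (p : ℝ≥0∞) (u : 𝓢(E3, ℂ)) : 0 ≤ lpn p u := ENNReal.toReal_nonneg

theorem eLpNorm_ne_top_schwartz (p : ℝ≥0∞) (u : 𝓢(E3, ℂ)) : eLpNorm u p volume ≠ ⊤ :=
  (SchwartzMap.eLpNorm_lt_top u p _).ne

theorem ofReal_lpn (p : ℝ≥0∞) (u : 𝓢(E3, ℂ)) :
    ENNReal.ofReal (lpn p u) = eLpNorm u p volume :=
  ENNReal.ofReal_toReal (eLpNorm_ne_top_schwartz p u)

theorem lpn_mulS_le (p : ℝ≥0∞) (u v : 𝓢(E3, ℂ)) : lpn p (mulS u v) ≤ lpn ⊤ u * lpn p v := by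
  rw [lpn, lpn, lpn, ← ENNReal.toReal_mul]
  exact ENNReal.toReal_mono (ENNReal.mul_ne_top (eLpNorm_ne_top_schwartz _ _)
    (eLpNorm_ne_top_schwartz _ _)) (eLpNorm_mulS_le u v p)

theorem lpn_sum_le {ι : Type*} (s : Finset ι) (F : ι → 𝓢(E3, ℂ)) {p : ℝ≥0∞} (hp : 1 ≤ p) :
    lpn p (∑ i ∈ s, F i) ≤ ∑ i ∈ s, lpn p (F i) := by
  have hcoe : ⇑(∑ i ∈ s, F i) = ∑ i ∈ s, ⇑(F i) := by ext x; simp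
  simp only [lpn]
  rw [← ENNReal.toReal_sum fun i _ => eLpNorm_ne_top_schwartz _ _, hcoe]
  exact ENNReal.toReal_mono (ENNReal.sum_ne_top.mpr fun i _ => eLpNorm_ne_top_schwartz _ _)
    (eLpNorm_sum_le (fun i _ => (SchwartzMap.continuous _).aestronglyMeasurable) hp)

theorem lpn_fmul_blockSymbol_le (P : LPCutoff) (n : ℕ) (f : 𝓢(E3, ℂ)) {p : ℝ≥0∞} (hp : 1 ≤ p) :
    lpn p (fmul (P.blockSymbol n) f) ≤
      (lpn 1 (𝓕⁻ P.lowSymbol) + lpn 1 (𝓕⁻ P.annulusSymbol)) * lpn p f := by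
  simp only [lpn]
  rw [← ENNReal.toReal_add (eLpNorm_ne_top_schwartz _ _) (eLpNorm_ne_top_schwartz _ _),
    ← ENNReal.toReal_mul]
  exact ENNReal.toReal_mono (ENNReal.mul_ne_top (ENNReal.add_ne_top.mpr
    ⟨eLpNorm_ne_top_schwartz _ _, eLpNorm_ne_top_schwartz _ _⟩) (eLpNorm_ne_top_schwartz _ _))
    (eLpNorm_fmul_blockSymbol_le P n f hp)

theorem lpn_fmul_dilate_le {c : ℝ} (hc : c ≠ 0) (m f : 𝓢(E3, ℂ)) {p : ℝ≥0∞} (hp : 1 ≤ p) :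
    lpn p (fmul (dilate c hc m) f) ≤ lpn 1 (𝓕⁻ m) * lpn p f := by
  simp only [lpn]
  rw [← ENNReal.toReal_mul]
  exact ENNReal.toReal_mono (ENNReal.mul_ne_top (eLpNorm_ne_top_schwartz _ _)
    (eLpNorm_ne_top_schwartz _ _)) (eLpNorm_fmul_dilate_le hc m f hp)

theorem lpn_fmul_blockSymbol_succ_le (P : LPCutoff) (m : ℕ) (g : 𝓢(E3, ℂ)) {p : ℝ≥0∞}
    (hp : 1 ≤ p) :
    lpn p (fmul (P.blockSymbol (m + 1)) g) ≤ (2 : ℝ) ^ (-(m : ℤ)) *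
      ∑ j, lpn 1 (𝓕⁻ (rieszSymbol j)) * lpn p (fmul (P.blockSymbol (m + 1)) (pdS j g)) := by
  have hfin : ∀ j, eLpNorm (𝓕⁻ (rieszSymbol j) : 𝓢(E3, ℂ)) 1 volume *
      eLpNorm (fmul (P.blockSymbol (m + 1)) (pdS j g)) p volume ≠ ⊤ := fun j =>
    ENNReal.mul_ne_top (eLpNorm_ne_top_schwartz _ _) (eLpNorm_ne_top_schwartz _ _)
  have h := ENNReal.toReal_mono (ENNReal.mul_ne_top ENNReal.ofReal_ne_top
    (ENNReal.sum_ne_top.mpr fun j _ => hfin j)) (eLpNorm_fmul_blockSymbol_succ_le P m g hp)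
  rw [ENNReal.toReal_mul, ENNReal.toReal_ofReal (by positivity),
    ENNReal.toReal_sum fun j _ => hfin j] at h
  simpa only [ENNReal.toReal_mul, lpn] using h

/-- The `l`-th term of the paraproduct, as a Schwartz function. -/
def paraTerm (P : LPCutoff) (f g : 𝓢(E3, ℂ)) (l : ℕ) : 𝓢(E3, ℂ) :=
  mulS (fmul (dilate ((2 : ℝ) ^ (-(l : ℤ))) (two_zpow_ne_zero _) P.lowSymbol) f)
    (fmul (P.blockSymbol (l + 2)) g)

theorem paraproduct_eq_tsum (P : LPCutoff) (f g : 𝓢(E3, ℂ)) :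
    paraproduct P f g = fun x => ∑' l, paraTerm P f g l x := by
  ext x
  simp only [paraproduct, LPlow_eq_fmul, LPblock_eq_fmul]
  rfl

theorem norm_zpow_neg_smul (m : ℕ) (ξ : E3) :
    ‖(2 : ℝ) ^ (-(m : ℤ)) • ξ‖ = ‖ξ‖ / 2 ^ m := by
  rw [norm_smul, zpow_neg, zpow_natCast, norm_inv, norm_pow, Real.norm_two, inv_mul_eq_div]

theorem LPCutoff.blockSymbol_succ_eq_zero (P : LPCutoff) {m : ℕ} {ξ : E3}
    (h : ‖ξ‖ < 3 / 4 * 2 ^ m ∨ 8 / 3 * 2 ^ m < ‖ξ‖) : P.blockSymbol (m + 1) ξ = 0 := by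
  have h2 : (0 : ℝ) < 2 ^ m := by positivity
  rw [LPCutoff.blockSymbol, dilate_apply, P.annulusSymbol_apply, P.supp_φ, Complex.ofReal_zero]
  rw [norm_zpow_neg_smul, div_lt_iff₀ h2, lt_div_iff₀ h2]
  exact h

theorem LPCutoff.dilate_lowSymbol_eq_zero (P : LPCutoff) {m : ℕ} {ξ : E3}
    (h : 4 / 3 * 2 ^ m < ‖ξ‖) :
    dilate ((2 : ℝ) ^ (-(m : ℤ))) (two_zpow_ne_zero _) P.lowSymbol ξ = 0 := by
  have h2 : (0 : ℝ) < 2 ^ m := by positivity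
  rw [dilate_apply, P.lowSymbol_apply, P.supp_χ, Complex.ofReal_zero]
  rw [norm_zpow_neg_smul, lt_div_iff₀ h2]
  exact h

theorem fourier_paraTerm_eq_zero (P : LPCutoff) (f g : 𝓢(E3, ℂ)) (l : ℕ) {ξ : E3}
    (h : ‖ξ‖ < 1 / 6 * 2 ^ l ∨ 20 / 3 * 2 ^ l < ‖ξ‖) : 𝓕 (paraTerm P f g l) ξ = 0 := by
  refine fourier_mulS_eq_zero (R := 4 / 3 * 2 ^ l) (a := 3 / 4 * 2 ^ (l + 1))
    (b := 8 / 3 * 2 ^ (l + 1)) (fun η hη => ?_) (fun η hη => ?_) ?_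
  · rw [fourier_fmul, P.dilate_lowSymbol_eq_zero hη, zero_mul]
  · rw [fourier_fmul, P.blockSymbol_succ_eq_zero hη, zero_mul]
  · rw [pow_succ]
    refine h.imp (fun h => ?_) fun h => ?_ <;> linarith

theorem blockSymbol_mul_fourier_paraTerm (P : LPCutoff) (f g : 𝓢(E3, ℂ)) {n l : ℕ}
    (h : n + 4 ≤ l ∨ l + 5 ≤ n) (ξ : E3) :
    P.blockSymbol n ξ * 𝓕 (paraTerm P f g l) ξ = 0 := by
  have hpow : ∀ {a b : ℕ}, a ≤ b → (2 : ℝ) ^ a ≤ 2 ^ b := fun h => pow_le_pow_right₀ one_le_two h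
  by_cases hz : ‖ξ‖ < 1 / 6 * 2 ^ l ∨ 20 / 3 * 2 ^ l < ‖ξ‖
  · rw [fourier_paraTerm_eq_zero P f g l hz, mul_zero]
  push Not at hz
  suffices P.blockSymbol n ξ = 0 by rw [this, zero_mul]
  cases n with
  | zero =>
    have h4 : 4 ≤ l := by omega
    have := hpow h4
    show P.lowSymbol ξ = 0
    rw [P.lowSymbol_apply, P.supp_χ, Complex.ofReal_zero]
    linarith [hz.1]
  | succ m =>
    have hm : (0 : ℝ) < 2 ^ m := by positivity
    refine P.blockSymbol_succ_eq_zero ?_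
    rcases h with h | h
    · right
      have := hpow (show m + 5 ≤ l by omega)
      rw [pow_add] at this
      linarith [hz.1]
    · left
      have := hpow (show l + 4 ≤ m by omega)
      rw [pow_add] at this
      linarith [hz.2]

theorem lpn_paraTerm_le (P : LPCutoff) (f g : 𝓢(E3, ℂ)) (l : ℕ) {p : ℝ≥0∞} (hp : 1 ≤ p) :
    lpn p (paraTerm P f g l) ≤ lpn 1 (𝓕⁻ P.lowSymbol) * lpn ⊤ f * ((2 : ℝ) ^ (-((l + 1 : ℕ) : ℤ)) *
      ∑ j, lpn 1 (𝓕⁻ (rieszSymbol j)) * lpn p (fmul (P.blockSymbol (l + 2)) (pdS j g))) := by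
  refine (lpn_mulS_le _ _ _).trans ?_
  refine mul_le_mul (lpn_fmul_dilate_le _ _ _ le_top)
    (lpn_fmul_blockSymbol_succ_le P (l + 1) g hp) (lpn_nonneg _ _)
    (mul_nonneg (lpn_nonneg _ _) (lpn_nonneg _ _))

theorem integral_norm_eq_lpn (u : 𝓢(E3, ℂ)) : ∫ x, ‖u x‖ = lpn 1 u := by
  rw [lpn, eLpNorm_one_eq_lintegral_enorm,
    integral_norm_eq_lintegral_enorm u.continuous.aestronglyMeasurable]

theorem summable_integral_norm_paraTerm (P : LPCutoff) (f g : 𝓢(E3, ℂ)) :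
    Summable fun l => ∫ x, ‖paraTerm P f g l x‖ := by
  simp_rw [integral_norm_eq_lpn]
  set A := lpn 1 (𝓕⁻ P.lowSymbol) + lpn 1 (𝓕⁻ P.annulusSymbol)
  set M := lpn 1 (𝓕⁻ P.lowSymbol) * lpn ⊤ f *
    ∑ j, lpn 1 (𝓕⁻ (rieszSymbol j)) * (A * lpn 1 (pdS j g))
  refine Summable.of_nonneg_of_le (f := fun l : ℕ => M * (1 / 2) ^ (l + 1))
    (fun l => lpn_nonneg _ _) (fun l => (lpn_paraTerm_le P f g l le_rfl).trans ?_)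
    (((summable_nat_add_iff 1).mpr summable_geometric_two).mul_left M)
  have h2 : (2 : ℝ) ^ (-((l + 1 : ℕ) : ℤ)) = (1 / 2) ^ (l + 1) := by
    rw [zpow_neg, zpow_natCast, one_div, inv_pow]
  rw [h2, mul_comm ((1 / 2 : ℝ) ^ (l + 1)), ← mul_assoc]
  refine mul_le_mul_of_nonneg_right (mul_le_mul_of_nonneg_left (Finset.sum_le_sum fun j _ =>
    mul_le_mul_of_nonneg_left (lpn_fmul_blockSymbol_le P _ _ le_rfl) (lpn_nonneg _ _))
    (mul_nonneg (lpn_nonneg _ _) (lpn_nonneg _ _))) (by positivity)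

theorem fourier_paraproduct (P : LPCutoff) (f g : 𝓢(E3, ℂ)) (ξ : E3) :
    𝓕 (paraproduct P f g) ξ = ∑' l, 𝓕 (paraTerm P f g l) ξ := by
  simp_rw [SchwartzMap.fourier_coe, paraproduct_eq_tsum, Real.fourier_eq]
  rw [integral_tsum_of_summable_integral_norm]
  · congr 1
    ext x
    simp_rw [Circle.smul_def, smul_eq_mul]
    rw [tsum_mul_left]
  · intro l
    exact (Real.fourierIntegral_convergent_iff ξ).2 (SchwartzMap.integrable _)
  · simpa only [Circle.norm_smul] using summable_integral_norm_paraTerm P f g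

theorem LPblock_paraproduct (P : LPCutoff) (f g : 𝓢(E3, ℂ)) (n : ℕ) :
    LPblock P n (paraproduct P f g) =
      ∑ l ∈ Finset.range (n + 4), fmul (P.blockSymbol n) (paraTerm P f g l) := by
  set F := ∑ l ∈ Finset.range (n + 4), fmul (P.blockSymbol n) (paraTerm P f g l) with hF
  rw [LPblock_eq_fourierInv]
  have h : (fun ξ => P.blockSymbol n ξ * 𝓕 (paraproduct P f g) ξ) = ⇑(𝓕 F : 𝓢(E3, ℂ)) := by
    ext ξ
    have h1 : 𝓕 F = ∑ l ∈ Finset.range (n + 4),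
        (𝓕 (fmul (P.blockSymbol n) (paraTerm P f g l)) : 𝓢(E3, ℂ)) :=
      map_sum (FourierTransform.fourierCLM ℂ 𝓢(E3, ℂ)) _ _
    rw [h1, sum_apply, fourier_paraproduct, ← tsum_mul_left]
    simp_rw [fourier_fmul]
    refine tsum_eq_sum fun l hl => blockSymbol_mul_fourier_paraTerm P f g (Or.inl ?_) ξ
    simpa using hl
  rw [h, ← SchwartzMap.fourierInv_coe]
  simp

theorem fmul_paraTerm_eq_zero (P : LPCutoff) (f g : 𝓢(E3, ℂ)) {n l : ℕ} (h : l + 5 ≤ n) :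
    fmul (P.blockSymbol n) (paraTerm P f g l) = 0 := by
  refine schwartz_ext_fourier fun ξ => ?_
  rw [fourier_fmul, blockSymbol_mul_fourier_paraTerm P f g (Or.inr h)]
  have : 𝓕 (0 : 𝓢(E3, ℂ)) = 0 := map_zero (FourierTransform.fourierCLM ℂ 𝓢(E3, ℂ))
  rw [this]; rfl

theorem measurableEmbedding_add_right_nat (i : ℕ) : MeasurableEmbedding fun n : ℕ => n + i :=
  ⟨add_left_injective i, measurable_of_countable _, fun _ _ => .of_discrete⟩

theorem map_add_right_count (i : ℕ) : Measure.map (fun n : ℕ => n + i) Measure.count =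
    Measure.count.restrict (Set.range fun n : ℕ => n + i) := by
  have he := measurableEmbedding_add_right_nat i
  rw [← he.map_comap]
  congr 1
  ext t _
  rw [he.comap_apply, Measure.count_injective_image (add_left_injective i)]

theorem eLpNorm_comp_add_le (c : ℕ → ℝ) (i : ℕ) (r : ℝ≥0∞) :
    eLpNorm (fun n => c (n + i)) r Measure.count ≤ eLpNorm c r Measure.count := by
  rw [show (fun n => c (n + i)) = c ∘ fun n => n + i from rfl,
    ← (measurableEmbedding_add_right_nat i).eLpNorm_map_measure, map_add_right_count]
  exact eLpNorm_mono_measure _ Measure.restrict_le_self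

/-- The sequence `d` delayed by `i`, preceded by zeros. -/
def delay (i : ℕ) (d : ℕ → ℝ) (k : ℕ) : ℝ := if i ≤ k then d (k - i) else 0

theorem eLpNorm_delay_le (d : ℕ → ℝ) (i : ℕ) (r : ℝ≥0∞) :
    eLpNorm (delay i d) r Measure.count ≤ eLpNorm d r Measure.count := by
  have h3 : delay i d = (Set.range fun n : ℕ => n + i).indicator (delay i d) := by
    ext k
    by_cases hk : i ≤ k
    · have hmem : k ∈ Set.range fun n : ℕ => n + i := ⟨k - i, Nat.sub_add_cancel hk⟩
      rw [Set.indicator_of_mem hmem]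
    · rw [Set.indicator_of_notMem, delay, if_neg hk]
      rintro ⟨n, rfl⟩
      exact hk (Nat.le_add_left _ _)
  have h4 : delay i d ∘ (fun n => n + i) = d := by
    ext n; simp [delay]
  rw [h3, eLpNorm_indicator_eq_eLpNorm_restrict .of_discrete, ← map_add_right_count,
    (measurableEmbedding_add_right_nat i).eLpNorm_map_measure, h4]

theorem sum_range_le_sum_delay {X d : ℕ → ℝ} {n : ℕ}
    (h0 : ∀ l, l + 5 ≤ n → X l = 0) (h1 : ∀ l, l < n + 4 → n ≤ l + 4 → X l ≤ d l) :
    ∑ l ∈ Finset.range (n + 4), X l ≤ ∑ i ∈ Finset.range 8, delay 4 d (n + i) := by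
  have e1 : ∑ k ∈ Finset.range (4 + (n + 4)), delay 4 X k = ∑ l ∈ Finset.range (n + 4), X l := by
    rw [Finset.sum_range_add, Finset.sum_eq_zero, zero_add]
    · simp [delay]
    · intro k hk
      rw [Finset.mem_range] at hk
      rw [delay, if_neg (by omega)]
  rw [← e1, show 4 + (n + 4) = n + 8 by ring, Finset.sum_range_add, Finset.sum_eq_zero, zero_add]
  · refine Finset.sum_le_sum fun i hi => ?_
    rw [Finset.mem_range] at hi
    simp only [delay]
    split_ifs with h
    · exact h1 _ (by omega) (by omega)
    · exact le_rfl
  · intro k hk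
    rw [Finset.mem_range] at hk
    rw [delay]
    split_ifs with h
    · exact h0 _ (by omega)
    · rfl

theorem eLpNorm_le_of_le_sum_delay {a d : ℕ → ℝ} {r : ℝ≥0∞} (hr : 1 ≤ r)
    (h : ∀ n, ‖a n‖ ≤ ∑ i ∈ Finset.range 8, delay 4 d (n + i)) :
    eLpNorm a r Measure.count ≤ 8 * eLpNorm d r Measure.count := by
  have h' : ∀ n, ‖a n‖ ≤ (∑ i ∈ Finset.range 8, fun n => delay 4 d (n + i)) n := fun n => by
    simpa only [Finset.sum_apply] using h n
  refine (eLpNorm_mono_real h').trans ((eLpNorm_sum_le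
    (fun i _ => Measurable.of_discrete.aestronglyMeasurable) hr).trans ?_)
  refine (Finset.sum_le_card_nsmul _ _ (eLpNorm d r Measure.count) fun i _ =>
    (eLpNorm_comp_add_le _ i r).trans (eLpNorm_delay_le d 4 r)).trans_eq ?_
  simp

theorem AFweight.monotone {δ : ℝ} {ω : ℕ → ℝ} (h : AFweight δ ω) : Monotone ω :=
  monotone_nat_of_le_succ fun k => (h k).2.1

theorem AFweight.pos {δ : ℝ} {ω : ℕ → ℝ} (h : AFweight δ ω) (k : ℕ) : 0 < ω k :=
  zero_lt_one.trans_le (h k).1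

theorem AFweight.le_of_le_add_two {δ : ℝ} {ω : ℕ → ℝ} (h : AFweight δ ω) {n m : ℕ}
    (hnm : n ≤ m + 2) : ω n ≤ (2 : ℝ) ^ (2 * δ) * ω m := by
  have h1 : ω n ≤ ω (m + 2) := h.monotone hnm
  have h2 := (h (m + 1)).2.2
  have h3 := mul_le_mul_of_nonneg_left (h m).2.2 (Real.rpow_nonneg zero_le_two δ)
  rw [← mul_assoc, ← Real.rpow_add two_pos, ← two_mul] at h3
  linarith

theorem two_rpow_mul_le (s : ℝ) {n m : ℕ} (h1 : n ≤ m + 5) (h2 : m ≤ n + 5) :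
    (2 : ℝ) ^ (((n : ℝ) - 1) * s) ≤ 2 ^ (5 * |s|) * 2 ^ (((m : ℝ) - 1) * s) := by
  rw [← Real.rpow_add two_pos]
  refine Real.rpow_le_rpow_of_exponent_le one_le_two ?_
  have hab : |(n : ℝ) - m| ≤ 5 := by
    rw [abs_le]
    have h1' : (n : ℝ) ≤ m + 5 := by exact_mod_cast h1
    have h2' : (m : ℝ) ≤ n + 5 := by exact_mod_cast h2
    constructor <;> linarith
  have := (le_abs_self (((n : ℝ) - m) * s)).trans_eq (abs_mul _ _)
  have := mul_le_mul_of_nonneg_right hab (abs_nonneg s)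
  nlinarith

theorem sum_mul_le_sum_mul_sqrt (b x : Fin 3 → ℝ) (hb : ∀ j, 0 ≤ b j) :
    ∑ j, b j * x j ≤ (∑ j, b j) * (∑ j, x j ^ 2) ^ ((1 : ℝ) / 2) := by
  rw [Finset.sum_mul, ← Real.sqrt_eq_rpow]
  refine Finset.sum_le_sum fun j _ => mul_le_mul_of_nonneg_left ?_ (hb j)
  refine Real.le_sqrt_of_sq_le ?_
  exact Finset.single_le_sum (f := fun j => x j ^ 2) (fun i _ => sq_nonneg _) (Finset.mem_univ j)

/-- Lemma 2.5, first inequality: `∥T_f g∥_{B^s_{p,r}(ω)} ≤ C ∥f∥_{L^∞} ∥∇g∥_{B^{s-1}_{p,r}(ω)}`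
with `C` independent of the weight `ω ∈ AF(δ)`. -/
theorem paraproduct_weighted_Linfty (δ s : ℝ) (hδ : 0 < δ) (p r : ℝ≥0∞)
    (hp : 1 ≤ p) (hr : 1 ≤ r) (P : LPCutoff) :
    ∃ C : ℝ, 0 < C ∧ ∀ ω : ℕ → ℝ, AFweight δ ω → ∀ f g : SchwartzMap E3 ℂ,
      besovW P ω s p r (paraproduct P ⇑f ⇑g) ≤
        ENNReal.ofReal C * eLpNorm (⇑f) ⊤ volume * gradBesovW P ω (s - 1) p r ⇑g := by
  obtain ⟨B, hB0, hB⟩ : ∃ B, 0 ≤ B ∧ lpn 1 (𝓕⁻ P.lowSymbol) = B := ⟨_, lpn_nonneg _ _, rfl⟩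
  obtain ⟨A, hA0, hA⟩ : ∃ A, 0 ≤ A ∧
      lpn 1 (𝓕⁻ P.lowSymbol) + lpn 1 (𝓕⁻ P.annulusSymbol) = A :=
    ⟨_, add_nonneg (lpn_nonneg _ _) (lpn_nonneg _ _), rfl⟩
  obtain ⟨R, hR0, hR⟩ : ∃ R, 0 ≤ R ∧ ∑ j, lpn 1 (𝓕⁻ (rieszSymbol j)) = R :=
    ⟨_, Finset.sum_nonneg fun j _ => lpn_nonneg _ _, rfl⟩
  obtain ⟨K, hK0, hK⟩ : ∃ K, 0 ≤ K ∧ (2 : ℝ) ^ (2 * δ) * 2 ^ (5 * |s|) * (A * B * R) = K :=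
    ⟨_, by positivity, rfl⟩
  refine ⟨8 * (K + 1), by positivity, fun ω hω f g => ?_⟩
  set G : ℕ → ℝ := fun n =>
    (∑ j : Fin 3, ((eLpNorm (LPblock P n (pdC j g)) p volume).toReal) ^ 2) ^ ((1 : ℝ) / 2) with hG
  have hG0 : ∀ n, 0 ≤ G n := fun n => by positivity
  have hGle : ∀ n, ∑ j, lpn 1 (𝓕⁻ (rieszSymbol j)) * lpn p (fmul (P.blockSymbol n) (pdS j g)) ≤
      R * G n := by
    intro n
    refine (sum_mul_le_sum_mul_sqrt _ _ fun j => lpn_nonneg _ _).trans_eq ?_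
    simp only [hG, ← hR, ← coe_pdS, LPblock_eq_fmul, lpn]
  set c : ℕ → ℝ := fun n => ω n * (2 : ℝ) ^ (((n : ℝ) - 1) * (s - 1)) * G n with hc
  have hc0 : ∀ n, 0 ≤ c n := fun n => by have := hω.pos n; have := hG0 n; positivity
  have hf0 : 0 ≤ lpn ⊤ f := lpn_nonneg _ _
  set d : ℕ → ℝ := fun l => K * lpn ⊤ f * c (l + 2) with hd
  have hd0 : ∀ l, 0 ≤ d l := fun l => by have := hc0 (l + 2); positivity
  have hmain : ∀ n, ‖ω n * (2 : ℝ) ^ (((n : ℝ) - 1) * s) *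
      (eLpNorm (LPblock P n (paraproduct P f g)) p volume).toReal‖ ≤
      ∑ i ∈ Finset.range 8, delay 4 d (n + i) := by
    intro n
    have hw := hω.pos n
    rw [LPblock_paraproduct, Real.norm_of_nonneg (by positivity)]
    refine (mul_le_mul_of_nonneg_left (lpn_sum_le _ _ hp) (by positivity)).trans ?_
    rw [Finset.mul_sum]
    refine sum_range_le_sum_delay (fun l hl => ?_) fun l h1 h2 => ?_
    · rw [fmul_paraTerm_eq_zero P f g hl]
      simp [lpn]
    have hterm : lpn p (fmul (P.blockSymbol n) (paraTerm P f g l)) ≤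
        A * (B * lpn ⊤ f * ((2 : ℝ) ^ (-((l + 1 : ℕ) : ℤ)) * (R * G (l + 2)))) := by
      rw [← hA, ← hB]
      refine (lpn_fmul_blockSymbol_le P n _ hp).trans
        (mul_le_mul_of_nonneg_left ?_ (hA.symm ▸ hA0))
      refine (lpn_paraTerm_le P f g l hp).trans (mul_le_mul_of_nonneg_left
        (mul_le_mul_of_nonneg_left (hGle _) (by positivity)) (hB.symm ▸ mul_nonneg hB0 hf0))
    have hpow : (2 : ℝ) ^ (-((l + 1 : ℕ) : ℤ)) * 2 ^ ((((l + 2 : ℕ) : ℝ) - 1) * s) =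
        2 ^ ((((l + 2 : ℕ) : ℝ) - 1) * (s - 1)) := by
      rw [← Real.rpow_intCast, ← Real.rpow_add two_pos]
      congr 1
      push_cast
      ring
    have hGl := hG0 (l + 2)
    have hwl := hω.pos (l + 2)
    calc ω n * (2 : ℝ) ^ (((n : ℝ) - 1) * s) * lpn p (fmul (P.blockSymbol n) (paraTerm P f g l))
        ≤ ((2 : ℝ) ^ (2 * δ) * ω (l + 2)) *
            (2 ^ (5 * |s|) * 2 ^ ((((l + 2 : ℕ) : ℝ) - 1) * s)) *
            (A * (B * lpn ⊤ f * ((2 : ℝ) ^ (-((l + 1 : ℕ) : ℤ)) * (R * G (l + 2))))) := by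
          refine mul_le_mul (mul_le_mul (hω.le_of_le_add_two (by omega))
            (two_rpow_mul_le s (by omega) (by omega)) (by positivity) (by positivity))
            hterm (lpn_nonneg _ _) (by positivity)
      _ = d l := by
          simp only [hd, hc, ← hK, ← hpow]
          ring
  have hdn : eLpNorm d r Measure.count ≤
      ENNReal.ofReal (K * lpn ⊤ f) * gradBesovW P ω (s - 1) p r g := by
    have : d = (K * lpn ⊤ f) • fun l => c (l + 2) := rfl
    rw [this, eLpNorm_const_smul, Real.enorm_of_nonneg (by positivity)]
    gcongr
    exact eLpNorm_comp_add_le c 2 r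
  refine (eLpNorm_le_of_le_sum_delay hr hmain).trans ?_
  calc 8 * eLpNorm d r Measure.count
      ≤ 8 * (ENNReal.ofReal (K * lpn ⊤ f) * gradBesovW P ω (s - 1) p r g) := by gcongr
    _ = ENNReal.ofReal (8 * K) * eLpNorm f ⊤ volume * gradBesovW P ω (s - 1) p r g := by
        rw [← ofReal_lpn, ENNReal.ofReal_mul hK0, ENNReal.ofReal_mul (by norm_num : (0 : ℝ) ≤ 8)]
        simp only [ENNReal.ofReal_ofNat]
        ring
    _ ≤ _ := by gcongr; linarith

end
end

section
/- Let δ > 0, and let s₁, s₂ ∈ ℝ with s₁ + s₂ > 0; let 1 ≤ p, p₁, p₂, r, r₁, r₂ ≤ ∞ with 1/p = 1/p₁ + 1/p₂ and 1/r = 1/r₁ + 1/r₂; and let ω = (ω_k)_{k ≥ −1} ∈ AF(δ). There exists a constant C > 0, depending only on δ, s₁, s₂, the integrability indices and the cutoff pair (χ, φ) but not on ω, such that for all complex-valued Schwartz functions f, g on ℝ³: ∥R(f,g)∥_{B^{s₁+s₂}_{p,r}(ω)} ≤ C ∥f∥_{B^{s₁}_{p₁,r₁}} ∥g∥_{B^{s₂}_{p₂,r₂}(ω)},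 and also ∥R(f,g)∥_{B^{s₁+s₂}_{p,r}(ω)} ≤ C ∥f∥_{B^{s₁}_{p₁,r₁}(ω)} ∥g∥_{B^{s₂}_{p₂,r₂}}. -/
open MeasureTheory SchwartzMap Real
open scoped FourierTransform ENNReal NNReal

noncomputable section

/-! ### Two inequalities for `L^p` seminorms -/

theorem eLpNorm_tsum_le {α : Type*} [MeasurableSpace α] {μ : Measure α} {p : ℝ≥0∞} (hp : 1 ≤ p)
    {F : ℕ → α → ℝ≥0∞} (hF : ∀ n, Measurable (F n)) :
    eLpNorm (fun x => ∑' n, F n x) p μ ≤ ∑' n, eLpNorm (F n) p μ := by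
  have hfin (N : ℕ) : eLpNorm (fun x => ∑ n ∈ Finset.range N, F n x) p μ ≤
      ∑' n, eLpNorm (F n) p μ := by
    have h := eLpNorm_sum_le (μ := μ) (s := Finset.range N) (f := F)
      (fun n _ => (hF n).aestronglyMeasurable) hp
    refine le_trans (le_of_eq ?_) (h.trans (ENNReal.sum_le_tsum _))
    congr 1
    ext x
    simp
  rcases eq_or_ne p ∞ with rfl | hp'
  · rw [eLpNorm_exponent_top]
    refine essSup_le_of_ae_le _ ?_
    have h (N : ℕ) := (hfin N)
    simp only [eLpNorm_exponent_top] at h ⊢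
    filter_upwards [ae_all_iff.2 fun N : ℕ => ae_le_eLpNormEssSup (μ := μ)
      (f := fun x => ∑ n ∈ Finset.range N, F n x)] with x hx
    rw [enorm_eq_self, ENNReal.tsum_eq_iSup_nat]
    exact iSup_le fun N => (hx N).trans (h N)
  · have hp0 : p ≠ 0 := (zero_lt_one.trans_le hp).ne'
    have hpr : 0 < p.toReal := ENNReal.toReal_pos hp0 hp'
    rw [eLpNorm_eq_lintegral_rpow_enorm_toReal hp0 hp', one_div,
      ENNReal.rpow_inv_le_iff hpr]
    have key : ∀ x, ‖∑' n, F n x‖ₑ ^ p.toReal =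
        ⨆ N : ℕ, (∑ n ∈ Finset.range N, F n x) ^ p.toReal := by
      intro x
      rw [enorm_eq_self, ENNReal.tsum_eq_iSup_nat]
      exact (ENNReal.orderIsoRpow p.toReal hpr).map_iSup _
    simp_rw [key]
    rw [lintegral_iSup]
    · refine iSup_le fun N => ?_
      have := hfin N
      rwa [eLpNorm_eq_lintegral_rpow_enorm_toReal hp0 hp', one_div,
        ENNReal.rpow_inv_le_iff hpr] at this
    · intro N
      have : Measurable fun x => ∑ n ∈ Finset.range N, F n x :=
        Finset.measurable_fun_sum _ fun n _ => hF n
      exact this.pow_const _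
    · intro M N hMN x
      dsimp only
      gcongr

theorem eLpNorm_convolution_le {k h : E3 → ℂ} (hk : Continuous k) (hh : Continuous h)
    {p : ℝ≥0∞} (hp : 1 ≤ p) :
    eLpNorm (convolution k h (ContinuousLinearMap.mul ℂ ℂ) volume) p volume ≤
      eLpNorm k 1 volume * eLpNorm h p volume := by
  have hpt (x : E3) : ‖convolution k h (ContinuousLinearMap.mul ℂ ℂ) volume x‖ₑ ≤
      ∫⁻ t, ‖k t‖ₑ * ‖h (x - t)‖ₑ := by
    refine (enorm_integral_le_lintegral_enorm _).trans (le_of_eq ?_)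
    simp [enorm_mul]
  rw [eLpNorm_one_eq_lintegral_enorm]
  have hkm : Measurable fun t => ‖k t‖ₑ := hk.enorm.measurable
  have hhm (x : E3) : Measurable fun t => ‖h (x - t)‖ₑ := by
    have : Continuous fun t => h (x - t) := by fun_prop
    exact this.enorm.measurable
  rcases eq_or_ne p ∞ with rfl | hp'
  · rw [eLpNorm_exponent_top, eLpNorm_exponent_top]
    refine essSup_le_of_ae_le _ (Filter.Eventually.of_forall fun x => (hpt x).trans ?_)
    rw [← lintegral_mul_const _ hkm]
    refine lintegral_mono_ae ?_
    have h1 : ∀ᵐ t : E3, ‖h (x - t)‖ₑ ≤ eLpNormEssSup h volume :=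
      (quasiMeasurePreserving_sub_left volume x).ae ae_le_eLpNormEssSup
    filter_upwards [h1] with t ht
    gcongr
  · have hp0 : p ≠ 0 := (zero_lt_one.trans_le hp).ne'
    have hpr : 0 < p.toReal := ENNReal.toReal_pos hp0 hp'
    have hp1 : 1 ≤ p.toReal := by
      rw [← ENNReal.toReal_one]; exact ENNReal.toReal_mono hp' hp
    set q := p.toReal with hq
    have hjensen (x : E3) : (∫⁻ t, ‖k t‖ₑ * ‖h (x - t)‖ₑ) ^ q ≤
        (∫⁻ t, ‖k t‖ₑ) ^ (q - 1) * ∫⁻ t, ‖k t‖ₑ * ‖h (x - t)‖ₑ ^ q := by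
      have hinv : (1 - q⁻¹) + q⁻¹ = 1 := by ring
      have hq1 : q⁻¹ ≤ 1 := inv_le_one_of_one_le₀ hp1
      have := ENNReal.lintegral_mul_norm_pow_le (μ := (volume : Measure E3)) hkm.aemeasurable
        (hkm.mul ((hhm x).pow_const q)).aemeasurable (sub_nonneg.2 hq1)
        (inv_nonneg.2 hpr.le) hinv
      have hsplit (t : E3) : ‖k t‖ₑ ^ (1 - q⁻¹) * (‖k t‖ₑ * ‖h (x - t)‖ₑ ^ q) ^ q⁻¹ =
          ‖k t‖ₑ * ‖h (x - t)‖ₑ := by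
        rw [ENNReal.mul_rpow_of_nonneg _ _ (inv_nonneg.2 hpr.le), ← mul_assoc,
          ← ENNReal.rpow_add_of_nonneg _ _ (sub_nonneg.2 hq1) (inv_nonneg.2 hpr.le), hinv,
          ENNReal.rpow_one, ENNReal.rpow_rpow_inv hpr.ne']
      simp only [Pi.mul_apply, hsplit] at this
      calc _ ≤ ((∫⁻ t, ‖k t‖ₑ) ^ (1 - q⁻¹) *
            (∫⁻ t, ‖k t‖ₑ * ‖h (x - t)‖ₑ ^ q) ^ q⁻¹) ^ q := by gcongr
        _ = _ := by
          rw [ENNReal.mul_rpow_of_nonneg _ _ hpr.le, ENNReal.rpow_inv_rpow hpr.ne',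
            ← ENNReal.rpow_mul, sub_mul, inv_mul_cancel₀ hpr.ne', one_mul]
    rw [eLpNorm_eq_lintegral_rpow_enorm_toReal hp0 hp',
      eLpNorm_eq_lintegral_rpow_enorm_toReal hp0 hp',
      one_div, ENNReal.rpow_inv_le_iff hpr, ENNReal.mul_rpow_of_nonneg _ _ hpr.le,
      ENNReal.rpow_inv_rpow hpr.ne']
    have hjoint : Measurable (Function.uncurry fun (x t : E3) => ‖k t‖ₑ * ‖h (x - t)‖ₑ ^ q) := by
      have h1 : Continuous fun z : E3 × E3 => k z.2 := by fun_prop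
      have h2 : Continuous fun z : E3 × E3 => h (z.1 - z.2) := by fun_prop
      exact h1.enorm.measurable.mul (h2.enorm.measurable.pow_const q)
    calc _ ≤ ∫⁻ x, (∫⁻ t, ‖k t‖ₑ) ^ (q - 1) * ∫⁻ t, ‖k t‖ₑ * ‖h (x - t)‖ₑ ^ q :=
          lintegral_mono fun x => (ENNReal.rpow_le_rpow (hpt x) hpr.le).trans (hjensen x)
      _ = (∫⁻ t, ‖k t‖ₑ) ^ (q - 1) * ∫⁻ t, ∫⁻ x, ‖k t‖ₑ * ‖h (x - t)‖ₑ ^ q := by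
          rw [lintegral_const_mul _ hjoint.lintegral_prod_right,
            lintegral_lintegral_swap hjoint.aemeasurable]
      _ = (∫⁻ t, ‖k t‖ₑ) ^ (q - 1) * ((∫⁻ t, ‖k t‖ₑ) * ∫⁻ x, ‖h x‖ₑ ^ q) := by
          rw [← lintegral_mul_const _ hkm]
          congr 2
          ext t
          rw [lintegral_const_mul, lintegral_sub_right_eq_self (fun x => ‖h x‖ₑ ^ q) t]
          have : Continuous fun x => h (x - t) := by fun_prop
          exact this.enorm.measurable.pow_const q
      _ = _ := by
          rw [← mul_assoc]
          congr 1
          nth_rw 2 [← ENNReal.rpow_one (∫⁻ t, ‖k t‖ₑ)]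
          rw [← ENNReal.rpow_add_of_nonneg _ _ (sub_nonneg.2 hp1) zero_le_one, sub_add_cancel]

/-! ### Littlewood–Paley blocks as convolutions -/

/-- The Fourier multiplier of the block `LPblock P n`. -/
def lpSymbol (P : LPCutoff) (n : ℕ) (ξ : E3) : ℂ :=
  if n = 0 then (P.χ ξ : ℂ) else (P.φ ((2 : ℝ) ^ (-((n : ℤ) - 1)) • ξ) : ℂ)

theorem LPblock_eq (P : LPCutoff) (n : ℕ) (f : E3 → ℂ) :
    LPblock P n f = 𝓕⁻ (fun ξ => lpSymbol P n ξ * 𝓕 f ξ) := by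
  unfold LPblock lpSymbol
  split_ifs <;> rfl

theorem lpSymbol_zero (P : LPCutoff) (ξ : E3) : lpSymbol P 0 ξ = P.χ ξ := by
  simp [lpSymbol]

theorem lpSymbol_succ (P : LPCutoff) (m : ℕ) (ξ : E3) :
    lpSymbol P (m + 1) ξ = P.φ (((2 : ℝ) ^ m)⁻¹ • ξ) := by
  simp [lpSymbol]

theorem lpSymbol_one (P : LPCutoff) (ξ : E3) : lpSymbol P 1 ξ = P.φ ξ := by
  simp [lpSymbol]

theorem contDiff_lpSymbol (P : LPCutoff) (n : ℕ) : ContDiff ℝ (⊤ : ℕ∞) (lpSymbol P n) := by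
  cases n with
  | zero =>
    rw [show lpSymbol P 0 = fun ξ => (P.χ ξ : ℂ) from funext (lpSymbol_zero P)]
    exact Complex.ofRealCLM.contDiff.comp P.smooth_χ
  | succ m =>
    rw [show lpSymbol P (m + 1) = fun ξ => (P.φ (((2 : ℝ) ^ m)⁻¹ • ξ) : ℂ) from
      funext (lpSymbol_succ P m)]
    exact Complex.ofRealCLM.contDiff.comp (P.smooth_φ.comp (contDiff_const_smul _))

theorem lpSymbol_eq_zero_of_gt (P : LPCutoff) (n : ℕ) {ξ : E3} (hξ : 4 / 3 * 2 ^ n < ‖ξ‖) :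
    lpSymbol P n ξ = 0 := by
  cases n with
  | zero => simpa [lpSymbol_zero] using P.supp_χ ξ (by simpa using hξ)
  | succ m =>
    rw [lpSymbol_succ, P.supp_φ _ (Or.inr _), Complex.ofReal_zero]
    rw [norm_smul, norm_inv, norm_pow, Real.norm_ofNat, lt_inv_mul_iff₀ (by positivity)]
    rw [pow_succ] at hξ
    linarith

theorem lpSymbol_eq_zero_of_lt (P : LPCutoff) {n : ℕ} (hn : n ≠ 0) {ξ : E3}
    (hξ : ‖ξ‖ < 3 / 8 * 2 ^ n) : lpSymbol P n ξ = 0 := by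
  obtain ⟨m, rfl⟩ := Nat.exists_eq_succ_of_ne_zero hn
  rw [Nat.succ_eq_add_one, lpSymbol_succ, P.supp_φ _ (Or.inl _), Complex.ofReal_zero]
  rw [norm_smul, norm_inv, norm_pow, Real.norm_ofNat, inv_mul_lt_iff₀ (by positivity)]
  rw [Nat.succ_eq_add_one, pow_succ] at hξ
  linarith

theorem hasCompactSupport_lpSymbol (P : LPCutoff) (n : ℕ) :
    HasCompactSupport (lpSymbol P n) := by
  refine HasCompactSupport.intro (isCompact_closedBall (0 : E3) (4 / 3 * 2 ^ n)) fun ξ hξ => ?_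
  exact lpSymbol_eq_zero_of_gt P n (by simpa using hξ)

/-- The Fourier multiplier of `LPblock P n` as a Schwartz function. -/
def lpSymbolS (P : LPCutoff) (n : ℕ) : SchwartzMap E3 ℂ :=
  (hasCompactSupport_lpSymbol P n).toSchwartzMap (contDiff_lpSymbol P n)

theorem coe_lpSymbolS (P : LPCutoff) (n : ℕ) : ⇑(lpSymbolS P n) = lpSymbol P n := rfl

/-- The convolution kernel of `LPblock P n`. -/
def lpKernel (P : LPCutoff) (n : ℕ) : SchwartzMap E3 ℂ := 𝓕⁻ (lpSymbolS P n)

/-- `LPblock P n` as an operator on Schwartz functions. -/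
def lpBlockS (P : LPCutoff) (n : ℕ) (f : SchwartzMap E3 ℂ) : SchwartzMap E3 ℂ :=
  SchwartzMap.convolution (ContinuousLinearMap.mul ℂ ℂ) (lpKernel P n) f

theorem fourier_lpBlockS (P : LPCutoff) (n : ℕ) (f : SchwartzMap E3 ℂ) (ξ : E3) :
    𝓕 (lpBlockS P n f) ξ = lpSymbol P n ξ * 𝓕 f ξ := by
  rw [lpBlockS, SchwartzMap.fourier_convolution, lpKernel, FourierTransform.fourier_fourierInv_eq]
  rfl

theorem coe_lpBlockS (P : LPCutoff) (n : ℕ) (f : SchwartzMap E3 ℂ) :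
    ⇑(lpBlockS P n f) = LPblock P n ⇑f := by
  rw [LPblock_eq, ← FourierTransform.fourierInv_fourier_eq (F := SchwartzMap E3 ℂ)
    (lpBlockS P n f), SchwartzMap.fourierInv_coe]
  congr 1
  ext ξ
  rw [fourier_lpBlockS, SchwartzMap.fourier_coe]

theorem lpKernel_succ (P : LPCutoff) (m : ℕ) (x : E3) :
    lpKernel P (m + 1) x = ((2 : ℝ) ^ m) ^ 3 • lpKernel P 1 ((2 : ℝ) ^ m • x) := by
  rw [lpKernel, lpKernel, SchwartzMap.fourierInv_coe, SchwartzMap.fourierInv_coe,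
    Real.fourierInv_eq, Real.fourierInv_eq, coe_lpSymbolS, coe_lpSymbolS]
  have h := Measure.integral_comp_inv_smul_of_nonneg (volume : Measure E3)
    (fun ξ : E3 => Real.fourierChar (inner ℝ ξ ((2 : ℝ) ^ m • x)) • lpSymbol P 1 ξ)
    (R := (2 : ℝ) ^ m) (by positivity)
  rw [finrank_euclideanSpace_fin] at h
  rw [← h]
  congr 1
  ext ξ
  rw [inner_smul_left, inner_smul_right, lpSymbol_succ, lpSymbol_one]
  simp

theorem eLpNorm_one_lpKernel_succ (P : LPCutoff) (m : ℕ) :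
    eLpNorm (lpKernel P (m + 1)) 1 volume = eLpNorm (lpKernel P 1) 1 volume := by
  rw [eLpNorm_one_eq_lintegral_enorm, eLpNorm_one_eq_lintegral_enorm,
    ← ofReal_integral_norm_eq_lintegral_enorm (lpKernel P (m + 1)).integrable,
    ← ofReal_integral_norm_eq_lintegral_enorm (lpKernel P 1).integrable]
  congr 1
  simp_rw [lpKernel_succ P m, norm_smul]
  rw [integral_const_mul, Measure.integral_comp_smul_of_nonneg (volume : Measure E3)
    (fun x => ‖lpKernel P 1 x‖) _ (hR := by positivity), finrank_euclideanSpace_fin, smul_eq_mul,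
    ← mul_assoc, norm_pow, norm_pow, Real.norm_ofNat, mul_inv_cancel₀ (by positivity), one_mul]

theorem exists_eLpNorm_lpKernel_le (P : LPCutoff) :
    ∃ K : ℝ≥0, ∀ n, eLpNorm (lpKernel P n) 1 volume ≤ K := by
  have hfin (n : ℕ) : eLpNorm (lpKernel P n) 1 volume ≠ ∞ :=
    ((lpKernel P n).memLp 1 volume).eLpNorm_ne_top
  refine ⟨(eLpNorm (lpKernel P 0) 1 volume).toNNReal +
    (eLpNorm (lpKernel P 1) 1 volume).toNNReal, fun n => ?_⟩
  rw [ENNReal.coe_add, ENNReal.coe_toNNReal (hfin 0), ENNReal.coe_toNNReal (hfin 1)]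
  cases n with
  | zero => exact le_self_add
  | succ m => exact (eLpNorm_one_lpKernel_succ P m).le.trans le_add_self

theorem eLpNorm_lpBlockS_le (P : LPCutoff) {p : ℝ≥0∞} (hp : 1 ≤ p) (n : ℕ)
    (f : SchwartzMap E3 ℂ) :
    eLpNorm (lpBlockS P n f) p volume ≤
      eLpNorm (lpKernel P n) 1 volume * eLpNorm f p volume := by
  rw [show ⇑(lpBlockS P n f) = convolution (lpKernel P n) f (ContinuousLinearMap.mul ℂ ℂ) volume
    from funext (SchwartzMap.convolution_apply _ _ _)]
  exact eLpNorm_convolution_le (lpKernel P n).continuous f.continuous hp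

theorem exists_norm_lpSymbol_le (P : LPCutoff) :
    ∃ M : ℝ, 0 ≤ M ∧ ∀ n ξ, ‖lpSymbol P n ξ‖ ≤ M * (1 + ‖ξ‖) * (1 / 2) ^ n := by
  obtain ⟨M₀, hM₀⟩ := (contDiff_lpSymbol P 0).continuous.bounded_above_of_compact_support
    (hasCompactSupport_lpSymbol P 0)
  obtain ⟨M₁, hM₁⟩ := (contDiff_lpSymbol P 1).continuous.bounded_above_of_compact_support
    (hasCompactSupport_lpSymbol P 1)
  have h₀ : 0 ≤ M₀ := (norm_nonneg _).trans (hM₀ 0)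
  have h₁ : 0 ≤ M₁ := (norm_nonneg _).trans (hM₁ 0)
  refine ⟨M₀ + 8 / 3 * M₁, by positivity, fun n ξ => ?_⟩
  cases n with
  | zero =>
    have := hM₀ ξ
    have := norm_nonneg ξ
    have : 0 ≤ (M₀ + 8 / 3 * M₁) * ‖ξ‖ := by positivity
    nlinarith
  | succ m =>
    rcases lt_or_ge ‖ξ‖ (3 / 8 * 2 ^ (m + 1)) with h | h
    · rw [lpSymbol_eq_zero_of_lt P m.succ_ne_zero h, norm_zero]
      positivity
    · have h2 : ‖lpSymbol P (m + 1) ξ‖ ≤ M₁ := by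
        have := hM₁ (((2 : ℝ) ^ m)⁻¹ • ξ)
        rw [lpSymbol_one] at this
        rw [lpSymbol_succ]
        simpa using this
      refine h2.trans ?_
      have h3 : 3 / 8 ≤ ‖ξ‖ * (1 / 2) ^ (m + 1) := by
        rw [one_div, inv_pow, ← div_eq_mul_inv, le_div_iff₀ (by positivity)]
        exact h
      calc M₁ = 8 / 3 * M₁ * (3 / 8) := by ring
        _ ≤ (M₀ + 8 / 3 * M₁) * ((1 + ‖ξ‖) * (1 / 2) ^ (m + 1)) := by
          gcongr
          · linarith
          · refine h3.trans ?_
            gcongr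
            linarith
        _ = _ := by ring

theorem exists_norm_lpBlockS_le (P : LPCutoff) (f : SchwartzMap E3 ℂ) :
    ∃ C : ℝ, ∀ n x, ‖lpBlockS P n f x‖ ≤ C * (1 / 2) ^ n := by
  obtain ⟨M, hM, hsym⟩ := exists_norm_lpSymbol_le P
  refine ⟨M * ∫ ξ, (1 + ‖ξ‖) * ‖𝓕 f ξ‖, fun n x => ?_⟩
  have hinteg : Integrable fun ξ => (1 + ‖ξ‖) * ‖𝓕 f ξ‖ := by
    simp_rw [add_mul, one_mul]
    refine (𝓕 f).integrable.norm.add ?_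
    have h := (𝓕 f).integrable_pow_mul volume 1
    simp only [pow_one] at h
    exact h
  rw [coe_lpBlockS, LPblock_eq, Real.fourierInv_eq]
  refine (norm_integral_le_integral_norm _).trans ?_
  rw [mul_assoc, mul_comm _ ((1 / 2 : ℝ) ^ n), ← mul_assoc, ← integral_const_mul]
  refine integral_mono_of_nonneg (Filter.Eventually.of_forall fun ξ => norm_nonneg _)
    (hinteg.const_mul _) (Filter.Eventually.of_forall fun ξ => ?_)
  simp only [Circle.norm_smul, norm_mul, ← SchwartzMap.fourier_coe]
  calc _ ≤ M * (1 + ‖ξ‖) * (1 / 2) ^ n * ‖𝓕 f ξ‖ := by gcongr; exact hsym n ξ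
    _ = _ := by ring

/-! ### The terms of the remainder -/

theorem LPblock_tsum (P : LPCutoff) (j : ℕ) (h : ℕ → SchwartzMap E3 ℂ)
    (hsum : Summable fun n => ∫ y, ‖h n y‖) (x : E3) :
    HasSum (fun n => LPblock P j (h n) x) (LPblock P j (fun y => ∑' n, h n y) x) := by
  have hF (ξ : E3) : HasSum (fun n => 𝓕 (h n : E3 → ℂ) ξ) (𝓕 (fun y => ∑' n, h n y) ξ) := by
    simp_rw [Real.fourier_eq]
    have := hasSum_integral_of_summable_integral_norm (μ := (volume : Measure E3))
      (F := fun n y => Real.fourierChar (-inner ℝ y ξ) • h n y)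
      (fun n => (Real.fourierIntegral_convergent_iff ξ).2 (h n).integrable)
      (by simpa only [Circle.norm_smul] using hsum)
    convert! this using 3 with y
    simp_rw [Circle.smul_def, smul_eq_mul]
    exact tsum_mul_left.symm
  have hbound (n : ℕ) (ξ : E3) : ‖𝓕 (h n : E3 → ℂ) ξ‖ ≤ ∫ y, ‖h n y‖ :=
    VectorFourier.norm_fourierIntegral_le_integral_norm _ _ _ _ _
  simp_rw [LPblock_eq, Real.fourierInv_eq]
  have hinteg (n : ℕ) : Integrable fun ξ => lpSymbol P j ξ * 𝓕 (h n : E3 → ℂ) ξ := by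
    have := (lpBlockS P j (h n)).fourier_coe ▸ (𝓕 (lpBlockS P j (h n))).integrable (μ := volume)
    refine this.congr (Filter.Eventually.of_forall fun ξ => ?_)
    simp only [← SchwartzMap.fourier_coe]
    exact fourier_lpBlockS P j (h n) ξ
  have hsm : Integrable fun ξ => ‖lpSymbol P j ξ‖ := (lpSymbolS P j).integrable.norm
  have := hasSum_integral_of_summable_integral_norm (μ := (volume : Measure E3))
    (F := fun n ξ => Real.fourierChar (inner ℝ ξ x) • (lpSymbol P j ξ * 𝓕 (h n : E3 → ℂ) ξ))
    (fun n => by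
      have := (Real.fourierIntegral_convergent_iff (-x)).2 (hinteg n)
      simpa using this)
    (by
      refine Summable.of_nonneg_of_le (fun n => integral_nonneg fun ξ => norm_nonneg _)
        (fun n => ?_) (hsum.mul_left (∫ ξ, ‖lpSymbol P j ξ‖))
      simp only [Circle.norm_smul, norm_mul]
      rw [← integral_mul_const]
      refine integral_mono_of_nonneg (Filter.Eventually.of_forall fun ξ => by positivity)
        (hsm.mul_const _) (Filter.Eventually.of_forall fun ξ => ?_)
      exact mul_le_mul_of_nonneg_left (hbound n ξ) (norm_nonneg _))
  convert! this using 3 with ξ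
  simp_rw [Circle.smul_def, smul_eq_mul]
  rw [tsum_mul_left, tsum_mul_left, (hF ξ).tsum_eq]

theorem fourier_pairing_eq_zero (u v : SchwartzMap E3 ℂ) {a b : ℝ}
    (hu : ∀ ξ, a < ‖ξ‖ → 𝓕 u ξ = 0) (hv : ∀ ξ, b < ‖ξ‖ → 𝓕 v ξ = 0)
    {ξ : E3} (hξ : a + b < ‖ξ‖) :
    𝓕 (SchwartzMap.pairing (ContinuousLinearMap.mul ℂ ℂ) u v) ξ = 0 := by
  have hneg (w : SchwartzMap E3 ℂ) (η : E3) : 𝓕⁻ w η = 𝓕 w (-η) := by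
    rw [SchwartzMap.fourierInv_coe, SchwartzMap.fourier_coe, Real.fourierInv_eq_fourier_neg]
  have hconv : 𝓕⁻ (SchwartzMap.pairing (ContinuousLinearMap.mul ℂ ℂ) u v) =
      SchwartzMap.convolution (ContinuousLinearMap.mul ℂ ℂ) (𝓕⁻ u) (𝓕⁻ v) := by
    simp [SchwartzMap.convolution]
  rw [← neg_neg ξ, ← hneg, hconv, SchwartzMap.convolution_apply, convolution_def]
  refine (integral_congr_ae (Filter.Eventually.of_forall fun t => ?_)).trans (integral_zero _ _)
  simp only [ContinuousLinearMap.mul_apply', hneg]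
  rcases lt_or_ge a ‖t‖ with h | h
  · rw [hu _ (by rwa [norm_neg]), zero_mul]
  · rw [hv, mul_zero]
    have h2 : ‖ξ‖ ≤ ‖-(-ξ - t)‖ + ‖t‖ := by
      calc ‖ξ‖ = ‖-(-ξ - t) - t‖ := by congr 1; abel
        _ ≤ _ := norm_sub_le _ _
    linarith

/-- The sum `(Δ_{k-1} + Δ_k + Δ_{k+1}) g` of neighbouring blocks, as a Schwartz function
(with `n = k + 1`). -/
def lpTilde (P : LPCutoff) (n : ℕ) (g : SchwartzMap E3 ℂ) : SchwartzMap E3 ℂ :=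
  (if n = 0 then 0 else lpBlockS P (n - 1) g) + lpBlockS P n g + lpBlockS P (n + 1) g

/-- The terms of the remainder `lpRemainder`, as Schwartz functions. -/
def remainderTerm (P : LPCutoff) (f g : SchwartzMap E3 ℂ) (n : ℕ) : SchwartzMap E3 ℂ :=
  SchwartzMap.pairing (ContinuousLinearMap.mul ℂ ℂ) (lpBlockS P n f) (lpTilde P n g)

theorem remainderTerm_apply (P : LPCutoff) (f g : SchwartzMap E3 ℂ) (n : ℕ) (x : E3) :
    remainderTerm P f g n x = lpBlockS P n f x * lpTilde P n g x := rfl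

theorem lpRemainder_eq_tsum (P : LPCutoff) (f g : SchwartzMap E3 ℂ) :
    lpRemainder P f g = fun x => ∑' n, remainderTerm P f g n x := by
  ext x
  refine tsum_congr fun n => ?_
  rw [remainderTerm_apply, lpTilde]
  split_ifs <;> simp [coe_lpBlockS]

theorem fourier_lpTilde_eq_zero (P : LPCutoff) (n : ℕ) (g : SchwartzMap E3 ℂ) {ξ : E3}
    (hξ : 8 / 3 * 2 ^ n < ‖ξ‖) : 𝓕 (lpTilde P n g) ξ = 0 := by
  have hpos : (0 : ℝ) < 2 ^ n := by positivity
  have h (m : ℕ) (hm : m ≤ n + 1) : 𝓕 (lpBlockS P m g) ξ = 0 := by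
    rw [fourier_lpBlockS, lpSymbol_eq_zero_of_gt, zero_mul]
    have : (2 : ℝ) ^ m ≤ 2 ^ (n + 1) := pow_le_pow_right₀ one_le_two hm
    rw [pow_succ] at this
    linarith
  unfold lpTilde
  split_ifs
  · simp [FourierTransform.fourier_add, h n (by omega), h (n + 1) le_rfl]
  · simp [FourierTransform.fourier_add, h n (by omega), h (n + 1) le_rfl, h (n - 1) (by omega)]

theorem LPblock_remainderTerm_eq_zero (P : LPCutoff) (f g : SchwartzMap E3 ℂ) {j n : ℕ}
    (hjn : n + 3 < j) : LPblock P j (remainderTerm P f g n) = 0 := by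
  have hpos : (0 : ℝ) < 2 ^ n := by positivity
  have hz : (fun ξ => lpSymbol P j ξ * 𝓕 (remainderTerm P f g n : E3 → ℂ) ξ) = 0 := by
    ext ξ
    rcases lt_or_ge ‖ξ‖ (3 / 8 * 2 ^ j) with h | h
    · rw [lpSymbol_eq_zero_of_lt P (by omega) h, zero_mul, Pi.zero_apply]
    · have h2 : (2 : ℝ) ^ (n + 4) ≤ 2 ^ j := pow_le_pow_right₀ one_le_two hjn
      rw [pow_add] at h2
      have := fourier_pairing_eq_zero (lpBlockS P n f) (lpTilde P n g) (ξ := ξ)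
        (a := 4 / 3 * 2 ^ n) (b := 8 / 3 * 2 ^ n)
        (fun η hη => by rw [fourier_lpBlockS, lpSymbol_eq_zero_of_gt P n hη, zero_mul])
        (fun η hη => fourier_lpTilde_eq_zero P n g hη) (by linarith)
      rw [← SchwartzMap.fourier_coe, remainderTerm, this, mul_zero, Pi.zero_apply]
  rw [LPblock_eq, hz]
  ext x
  simp [Real.fourierInv_eq]

theorem eLpNorm_lpTilde_le (P : LPCutoff) {p : ℝ≥0∞} (hp : 1 ≤ p) (n : ℕ)
    (g : SchwartzMap E3 ℂ) :
    eLpNorm (lpTilde P n g) p volume ≤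
      (if n = 0 then 0 else eLpNorm (LPblock P (n - 1) g) p volume) +
        eLpNorm (LPblock P n g) p volume + eLpNorm (LPblock P (n + 1) g) p volume := by
  have hm (u : SchwartzMap E3 ℂ) : AEStronglyMeasurable u volume :=
    u.continuous.aestronglyMeasurable
  simp_rw [← coe_lpBlockS]
  unfold lpTilde
  refine (eLpNorm_add_le (hm _) (hm _) hp).trans ?_
  gcongr
  refine (eLpNorm_add_le (hm _) (hm _) hp).trans ?_
  gcongr
  split_ifs
  · exact (eLpNorm_zero (p := p)).le
  · rfl

theorem summable_integral_norm_remainderTerm (P : LPCutoff) (f g : SchwartzMap E3 ℂ) :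
    Summable fun n => ∫ y, ‖remainderTerm P f g n y‖ := by
  obtain ⟨C, hC⟩ := exists_norm_lpBlockS_le P f
  obtain ⟨K, hK⟩ := exists_eLpNorm_lpKernel_le P
  have hC0 : 0 ≤ C := by simpa using (norm_nonneg _).trans (hC 0 0)
  set D : ℝ≥0∞ := 3 * (K * eLpNorm g 1 volume) with hD
  have hg : eLpNorm g 1 volume ≠ ∞ := (g.memLp 1 volume).eLpNorm_ne_top
  have hDtop : D ≠ ∞ := by finiteness
  have htilde (n : ℕ) : ∫ y, ‖lpTilde P n g y‖ ≤ D.toReal := by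
    rw [integral_norm_eq_lintegral_enorm (lpTilde P n g).continuous.aestronglyMeasurable]
    refine ENNReal.toReal_mono hDtop ?_
    rw [← eLpNorm_one_eq_lintegral_enorm]
    have hb (m : ℕ) : eLpNorm (LPblock P m g) 1 volume ≤ K * eLpNorm g 1 volume := by
      rw [← coe_lpBlockS]
      exact (eLpNorm_lpBlockS_le P le_rfl m g).trans (by gcongr; exact hK m)
    refine (eLpNorm_lpTilde_le P le_rfl n g).trans ?_
    calc _ ≤ K * eLpNorm g 1 volume + K * eLpNorm g 1 volume + K * eLpNorm g 1 volume := by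
          gcongr
          · split_ifs
            · exact zero_le
            · exact hb _
          · exact hb _
          · exact hb _
      _ = D := by rw [hD]; ring
  refine Summable.of_nonneg_of_le (fun n => integral_nonneg fun y => norm_nonneg _) (fun n => ?_)
    ((summable_geometric_two.mul_left C).mul_right D.toReal)
  calc ∫ y, ‖remainderTerm P f g n y‖ ≤ ∫ y, C * (1 / 2) ^ n * ‖lpTilde P n g y‖ := by
        refine integral_mono (remainderTerm P f g n).integrable.norm
          ((lpTilde P n g).integrable.norm.const_mul _) fun y => ?_
        simp only [remainderTerm_apply, norm_mul]
        gcongr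
        exact hC n y
    _ = C * (1 / 2) ^ n * ∫ y, ‖lpTilde P n g y‖ := integral_const_mul _ _
    _ ≤ _ := by gcongr; exact htilde n

theorem eLpNorm_remainderTerm_le (P : LPCutoff) (p p₁ p₂ : ℝ≥0∞) [ENNReal.HolderTriple p₁ p₂ p]
    (f g : SchwartzMap E3 ℂ) (n : ℕ) :
    eLpNorm (remainderTerm P f g n) p volume ≤
      eLpNorm (lpBlockS P n f) p₁ volume * eLpNorm (lpTilde P n g) p₂ volume := by
  have h : (remainderTerm P f g n : E3 → ℂ) =
      (lpBlockS P n f : E3 → ℂ) • (lpTilde P n g : E3 → ℂ) := by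
    ext x
    rw [remainderTerm_apply, Pi.smul_apply', smul_eq_mul]
  rw [h]
  exact eLpNorm_smul_le_mul_eLpNorm (lpTilde P n g).continuous.aestronglyMeasurable
    (lpBlockS P n f).continuous.aestronglyMeasurable

theorem eLpNorm_LPblock_lpRemainder_le (P : LPCutoff) {K : ℝ≥0∞}
    (hK : ∀ n, eLpNorm (lpKernel P n) 1 volume ≤ K) {p p₁ p₂ : ℝ≥0∞} (hp : 1 ≤ p)
    (hp₂ : 1 ≤ p₂) [ENNReal.HolderTriple p₁ p₂ p] (f g : SchwartzMap E3 ℂ) (j : ℕ) :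
    eLpNorm (LPblock P j (lpRemainder P f g)) p volume ≤
      ∑' n, if j ≤ n + 3 then K * (eLpNorm (LPblock P n f) p₁ volume *
        ((if n = 0 then 0 else eLpNorm (LPblock P (n - 1) g) p₂ volume) +
        eLpNorm (LPblock P n g) p₂ volume + eLpNorm (LPblock P (n + 1) g) p₂ volume)) else 0 := by
  have hpt (x : E3) : ‖LPblock P j (lpRemainder P f g) x‖ₑ ≤
      ‖∑' n, ‖LPblock P j (remainderTerm P f g n) x‖ₑ‖ₑ := by
    rw [lpRemainder_eq_tsum, ← (LPblock_tsum P j (remainderTerm P f g)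
      (summable_integral_norm_remainderTerm P f g) x).tsum_eq, enorm_eq_self]
    exact enorm_tsum_le_tsum_enorm
  refine (eLpNorm_mono_enorm hpt).trans ((eLpNorm_tsum_le hp fun n => ?_).trans
    (ENNReal.tsum_le_tsum fun n => ?_))
  · rw [← coe_lpBlockS]
    exact (lpBlockS P j (remainderTerm P f g n)).continuous.enorm.measurable
  · rw [eLpNorm_enorm]
    by_cases hjn : j ≤ n + 3
    · rw [if_pos hjn]
      rw [← coe_lpBlockS P j (remainderTerm P f g n), ← coe_lpBlockS P n f]
      refine (eLpNorm_lpBlockS_le P hp j _).trans (mul_le_mul' (hK j) ?_)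
      exact (eLpNorm_remainderTerm_le P p p₁ p₂ f g n).trans
        (mul_le_mul_right (eLpNorm_lpTilde_le P hp₂ n g) _)
    · rw [if_neg hjn, LPblock_remainderTerm_eq_zero P f g (by omega), eLpNorm_zero]

/-! ### Weighted sequence inequalities -/

theorem tsum_le_tsum_of_injOn {u v : ℕ → ℝ≥0∞} (σ : ℕ → ℕ) {S : Set ℕ} (hσ : S.InjOn σ)
    (h0 : ∀ n ∉ S, u n = 0) (hle : ∀ n ∈ S, u n ≤ v (σ n)) : ∑' n, u n ≤ ∑' n, v n := by
  rw [← tsum_subtype_eq_of_support_subset (s := S) fun n hn => by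
    by_contra h
    exact hn (h0 n h)]
  exact (ENNReal.tsum_le_tsum fun n : S => hle n n.2).trans
    (ENNReal.tsum_comp_le_tsum_of_injective hσ.injective v)

theorem eLpNorm_count_eq_tsum {r : ℝ≥0∞} (h0 : r ≠ 0) (h1 : r ≠ ∞) {ε : Type*} [ENorm ε]
    (u : ℕ → ε) :
    eLpNorm u r Measure.count = (∑' n, ‖u n‖ₑ ^ r.toReal) ^ (1 / r.toReal) := by
  rw [eLpNorm_eq_lintegral_rpow_enorm_toReal h0 h1, lintegral_count]

theorem eLpNorm_count_le_of_injOn {ε ε' : Type*} [TopologicalSpace ε] [ESeminormedAddMonoid ε]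
    [TopologicalSpace ε'] [ESeminormedAddMonoid ε'] {u : ℕ → ε}
    {v : ℕ → ε'} (r : ℝ≥0∞) (σ : ℕ → ℕ) {S : Set ℕ} (hσ : S.InjOn σ) (h0 : ∀ n ∉ S, u n = 0)
    (hle : ∀ n ∈ S, ‖u n‖ₑ ≤ ‖v (σ n)‖ₑ) :
    eLpNorm u r (Measure.count : Measure ℕ) ≤ eLpNorm v r Measure.count := by
  rcases eq_or_ne r 0 with rfl | hr0
  · simp
  rcases eq_or_ne r ∞ with rfl | hr1
  · rw [eLpNorm_exponent_top, eLpNorm_exponent_top, eLpNormEssSup_count, eLpNormEssSup_count]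
    refine iSup_le fun n => ?_
    by_cases hn : n ∈ S
    · exact (hle n hn).trans (le_iSup (fun k => ‖v k‖ₑ) (σ n))
    · simp [h0 n hn]
  · have hpos := ENNReal.toReal_pos hr0 hr1
    rw [eLpNorm_count_eq_tsum hr0 hr1, eLpNorm_count_eq_tsum hr0 hr1]
    refine ENNReal.rpow_le_rpow (tsum_le_tsum_of_injOn σ hσ (fun n hn => ?_) fun n hn => ?_)
      (by positivity)
    · rw [h0 n hn, enorm_zero, ENNReal.zero_rpow_of_pos hpos]
    · exact ENNReal.rpow_le_rpow (hle n hn) hpos.le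

/-- Young's inequality for the convolution with a one-sided kernel. -/
theorem eLpNorm_tsum_shift_le {r : ℝ≥0∞} (hr : 1 ≤ r) (a : ℕ → ℝ≥0∞) (c : ℕ → ℝ) :
    eLpNorm (fun j => ∑' n, if j ≤ n + 3 then a (n + 3 - j) * ‖c n‖ₑ else 0) r
        (Measure.count : Measure ℕ) ≤ (∑' m, a m) * eLpNorm c r Measure.count := by
  set c' : ℕ → ℝ≥0∞ := fun k => if 3 ≤ k then ‖c (k - 3)‖ₑ else 0 with hc'
  have hmeas (u : ℕ → ℝ≥0∞) : Measurable u := measurable_of_countable u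
  have h1 (j : ℕ) : (∑' n, if j ≤ n + 3 then a (n + 3 - j) * ‖c n‖ₑ else 0) ≤
      ∑' m, a m * c' (m + j) := by
    refine tsum_le_tsum_of_injOn (S := {n | j ≤ n + 3}) (fun n => n + 3 - j) ?_ ?_ ?_
    · intro x hx y hy hxy
      simp only [Set.mem_ofPred_eq] at hx hy hxy
      omega
    · intro n hn
      exact if_neg hn
    · intro n hn
      have hn' : j ≤ n + 3 := hn
      simp only [if_pos hn', hc', Nat.sub_add_cancel hn']
      simp
  have h2 (m : ℕ) : eLpNorm (fun j => a m * c' (m + j)) r (Measure.count : Measure ℕ) ≤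
      a m * eLpNorm c r Measure.count := by
    have h3 : eLpNorm (fun j => c' (m + j)) r (Measure.count : Measure ℕ) ≤
        eLpNorm c r Measure.count := by
      refine eLpNorm_count_le_of_injOn r (S := {j | 3 ≤ m + j}) (fun j => m + j - 3) ?_ ?_ ?_
      · intro x hx y hy hxy
        simp only [Set.mem_ofPred_eq] at hx hy hxy
        omega
      · intro n hn
        exact if_neg hn
      · intro n hn
        have hn' : 3 ≤ m + n := hn
        simp [hc', hn']
    refine le_trans ?_ (mul_le_mul_right h3 (a m))
    rcases eq_or_ne r ∞ with rfl | hr1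
    · simp only [eLpNorm_exponent_top, eLpNormEssSup_count, enorm_eq_self]
      rw [ENNReal.mul_iSup]
    · have hr0 : r ≠ 0 := (zero_lt_one.trans_le hr).ne'
      have hpos := ENNReal.toReal_pos hr0 hr1
      rw [eLpNorm_count_eq_tsum hr0 hr1, eLpNorm_count_eq_tsum hr0 hr1]
      simp only [enorm_eq_self, ENNReal.mul_rpow_of_nonneg _ _ hpos.le]
      rw [ENNReal.tsum_mul_left, ENNReal.mul_rpow_of_nonneg _ _ (by positivity), one_div,
        ENNReal.rpow_rpow_inv hpos.ne']
  calc _ ≤ eLpNorm (fun j => ∑' m, a m * c' (m + j)) r Measure.count :=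
        eLpNorm_mono_enorm fun j => by simpa only [enorm_eq_self] using h1 j
    _ ≤ ∑' m, eLpNorm (fun j => a m * c' (m + j)) r Measure.count :=
        eLpNorm_tsum_le hr fun m => hmeas _
    _ ≤ ∑' m, a m * eLpNorm c r Measure.count := ENNReal.tsum_le_tsum h2
    _ = _ := ENNReal.tsum_mul_right

/-- The sum of the neighbouring values of a sequence. -/
def neighbourSum (b : ℕ → ℝ) (n : ℕ) : ℝ :=
  (if n = 0 then 0 else b (n - 1)) + b n + b (n + 1)

theorem eLpNorm_neighbourSum_le {r : ℝ≥0∞} (hr : 1 ≤ r) (b : ℕ → ℝ) :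
    eLpNorm (neighbourSum b) r (Measure.count : Measure ℕ) ≤ 3 * eLpNorm b r Measure.count := by
  have hm (u : ℕ → ℝ) : AEStronglyMeasurable u (Measure.count : Measure ℕ) :=
    (measurable_of_countable u).aestronglyMeasurable
  have h1 : eLpNorm (fun n => if n = 0 then 0 else b (n - 1)) r (Measure.count : Measure ℕ) ≤
      eLpNorm b r Measure.count := by
    refine eLpNorm_count_le_of_injOn r (S := {n | n ≠ 0}) (fun n => n - 1) ?_ ?_ ?_
    · intro x hx y hy hxy
      simp only [Set.mem_ofPred_eq] at hx hy hxy
      omega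
    · intro n hn
      exact if_pos (not_not.1 hn)
    · intro n hn
      have hn' : n ≠ 0 := hn
      simp [hn']
  have h2 : eLpNorm (fun n => b (n + 1)) r (Measure.count : Measure ℕ) ≤
      eLpNorm b r Measure.count :=
    eLpNorm_count_le_of_injOn r (S := Set.univ) (fun n => n + 1)
      (fun x _ y _ hxy => Nat.succ_injective hxy) (fun n hn => absurd (Set.mem_univ n) hn)
      fun n _ => le_rfl
  calc _ ≤ eLpNorm (fun n => (if n = 0 then 0 else b (n - 1)) + b n) r Measure.count +
        eLpNorm (fun n => b (n + 1)) r Measure.count := eLpNorm_add_le (hm _) (hm _) hr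
    _ ≤ eLpNorm (fun n => if n = 0 then 0 else b (n - 1)) r Measure.count +
        eLpNorm b r Measure.count + eLpNorm (fun n => b (n + 1)) r Measure.count := by
      gcongr
      exact eLpNorm_add_le (hm _) (hm _) hr
    _ ≤ eLpNorm b r Measure.count + eLpNorm b r Measure.count + eLpNorm b r Measure.count := by
      gcongr
    _ = _ := by ring

theorem AFweight.le_add {δ : ℝ} {ω : ℕ → ℝ} (hω : AFweight δ ω) (n k : ℕ) :
    ω (n + k) ≤ ((2 : ℝ) ^ δ) ^ k * ω n := by
  induction k with
  | zero => simp
  | succ k ih =>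
    calc ω (n + k + 1) ≤ (2 : ℝ) ^ δ * ω (n + k) := (hω _).2.2
      _ ≤ (2 : ℝ) ^ δ * (((2 : ℝ) ^ δ) ^ k * ω n) := by gcongr
      _ = _ := by ring

theorem AFweight.le_of_le_add_three {δ : ℝ} {ω : ℕ → ℝ} (hω : AFweight δ ω)
    {j n : ℕ} (hjn : j ≤ n + 3) : ω j ≤ ((2 : ℝ) ^ δ) ^ 3 * ω n :=
  (monotone_nat_of_le_succ (fun k => (hω k).2.1) hjn).trans (hω.le_add n 3)

/-- The constant in the comparison of neighbouring terms `v_n 2^{ns} B_n`. -/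
theorem neighbour_weight_le {δ s : ℝ} (hδ : 0 < δ) {v B : ℕ → ℝ} (hv : ∀ n, 0 ≤ v n)
    (hB : ∀ n, 0 ≤ B n) (hv1 : ∀ n, v n ≤ v (n + 1)) (hv2 : ∀ n, v (n + 1) ≤ (2 : ℝ) ^ δ * v n)
    (n : ℕ) :
    v n * (2 : ℝ) ^ (((n : ℝ) - 1) * s) * neighbourSum B n ≤
      (2 : ℝ) ^ (δ + |s|) * neighbourSum (fun m => v m * (2 : ℝ) ^ (((m : ℝ) - 1) * s) * B m) n := by
  have h1 : (1 : ℝ) ≤ 2 ^ (δ + |s|) := Real.one_le_rpow one_le_two (by positivity)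
  have hnext : v n * (2 : ℝ) ^ (((n : ℝ) - 1) * s) * B (n + 1) ≤ (2 : ℝ) ^ (δ + |s|) *
      (v (n + 1) * (2 : ℝ) ^ ((((n + 1 : ℕ) : ℝ) - 1) * s) * B (n + 1)) := by
    rw [← mul_assoc, ← mul_assoc, mul_comm _ (v (n + 1)), mul_assoc (v (n + 1)),
      ← Real.rpow_add two_pos]
    have := hv (n + 1)
    have := hB (n + 1)
    gcongr
    · exact hv1 n
    · exact one_le_two
    · push_cast
      nlinarith [neg_abs_le s]
  have hself : v n * (2 : ℝ) ^ (((n : ℝ) - 1) * s) * B n ≤ (2 : ℝ) ^ (δ + |s|) *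
      (v n * (2 : ℝ) ^ (((n : ℝ) - 1) * s) * B n) := by
    have := hv n
    have := hB n
    exact le_mul_of_one_le_left (by positivity) h1
  unfold neighbourSum
  simp only [mul_add]
  refine add_le_add (add_le_add ?_ hself) hnext
  split_ifs with hn
  · simp
  · obtain ⟨m, rfl⟩ := Nat.exists_eq_succ_of_ne_zero hn
    simp only [Nat.succ_eq_add_one, Nat.add_sub_cancel]
    have := hv m
    have := hB m
    calc _ ≤ (2 : ℝ) ^ δ * v m * (2 : ℝ) ^ (|s| + ((m : ℝ) - 1) * s) * B m := by
          gcongr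
          · exact hv2 m
          · exact one_le_two
          · push_cast
            nlinarith [le_abs_self s]
      _ = _ := by
          rw [Real.rpow_add two_pos, Real.rpow_add two_pos]
          ring

theorem neighbourSum_nonneg {b : ℕ → ℝ} (hb : ∀ n, 0 ≤ b n) (n : ℕ) : 0 ≤ neighbourSum b n := by
  unfold neighbourSum
  have := hb n
  have := hb (n + 1)
  have := hb (n - 1)
  split_ifs <;> positivity

theorem ofReal_neighbourSum {b : ℕ → ℝ} (hb : ∀ n, 0 ≤ b n) (n : ℕ) :
    ENNReal.ofReal (neighbourSum b n) = (if n = 0 then 0 else ENNReal.ofReal (b (n - 1))) +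
      ENNReal.ofReal (b n) + ENNReal.ofReal (b (n + 1)) := by
  have h : 0 ≤ if n = 0 then 0 else b (n - 1) := by
    split_ifs
    exacts [le_rfl, hb _]
  rw [neighbourSum, ENNReal.ofReal_add (add_nonneg h (hb n)) (hb _), ENNReal.ofReal_add h (hb n)]
  split_ifs <;> simp

theorem eLpNorm_count_mul_le (r r₁ r₂ : ℝ≥0∞) [ENNReal.HolderTriple r₁ r₂ r] (a b : ℕ → ℝ) :
    eLpNorm (fun n => a n * b n) r (Measure.count : Measure ℕ) ≤
      eLpNorm a r₁ Measure.count * eLpNorm b r₂ Measure.count := by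
  have h : (fun n => a n * b n) = a • b := rfl
  rw [h]
  exact eLpNorm_smul_le_mul_eLpNorm (measurable_of_countable b).aestronglyMeasurable
    (measurable_of_countable a).aestronglyMeasurable

/-- The one-sided convolution kernel in the remainder estimate. -/
def remainderKernel (K δ s₁ s₂ : ℝ) (m : ℕ) : ℝ :=
  K * ((2 : ℝ) ^ δ) ^ 3 * (2 : ℝ) ^ (δ + |s₂|) * (2 : ℝ) ^ ((3 - (m : ℝ)) * (s₁ + s₂))

theorem remainderKernel_nonneg {K : ℝ} (hK : 0 ≤ K) (δ s₁ s₂ : ℝ) (m : ℕ) :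
    0 ≤ remainderKernel K δ s₁ s₂ m := by
  unfold remainderKernel
  positivity

theorem weight_mul_le {K δ s₁ s₂ : ℝ} (hK : 0 ≤ K) (hδ : 0 < δ) {ω u v : ℕ → ℝ}
    (hω : AFweight δ ω) (huv : ∀ n, ω n = u n * v n) (hu : ∀ n, 0 ≤ u n) (hv : ∀ n, 0 ≤ v n)
    (hv1 : ∀ n, v n ≤ v (n + 1)) (hv2 : ∀ n, v (n + 1) ≤ (2 : ℝ) ^ δ * v n)
    {A B : ℕ → ℝ} (hA : ∀ n, 0 ≤ A n) (hB : ∀ n, 0 ≤ B n) {j n : ℕ} (hjn : j ≤ n + 3) :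
    ω j * (2 : ℝ) ^ (((j : ℝ) - 1) * (s₁ + s₂)) * (K * (A n * neighbourSum B n)) ≤
      remainderKernel K δ s₁ s₂ (n + 3 - j) * (u n * (2 : ℝ) ^ (((n : ℝ) - 1) * s₁) * A n *
        neighbourSum (fun m => v m * (2 : ℝ) ^ (((m : ℝ) - 1) * s₂) * B m) n) := by
  have h1 := hω.le_of_le_add_three hjn
  have h2 := neighbour_weight_le (s := s₂) hδ hv hB hv1 hv2 n
  have h3 := hA n
  have h4 := neighbourSum_nonneg hB n
  have h5 := hu n
  have hexp : (2 : ℝ) ^ (((j : ℝ) - 1) * (s₁ + s₂)) =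
      (2 : ℝ) ^ ((3 - ((n + 3 - j : ℕ) : ℝ)) * (s₁ + s₂)) *
        ((2 : ℝ) ^ (((n : ℝ) - 1) * s₁) * (2 : ℝ) ^ (((n : ℝ) - 1) * s₂)) := by
    rw [← Real.rpow_add two_pos, ← Real.rpow_add two_pos, Nat.cast_sub hjn]
    congr 1
    push_cast
    ring
  unfold remainderKernel
  calc _ ≤ ((2 : ℝ) ^ δ) ^ 3 * ω n * (2 : ℝ) ^ (((j : ℝ) - 1) * (s₁ + s₂)) *
        (K * (A n * neighbourSum B n)) := by gcongr
    _ = K * ((2 : ℝ) ^ δ) ^ 3 * (2 : ℝ) ^ ((3 - ((n + 3 - j : ℕ) : ℝ)) * (s₁ + s₂)) *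
        (u n * (2 : ℝ) ^ (((n : ℝ) - 1) * s₁) * A n *
          (v n * (2 : ℝ) ^ (((n : ℝ) - 1) * s₂) * neighbourSum B n)) := by
      rw [hexp, huv]
      ring
    _ ≤ K * ((2 : ℝ) ^ δ) ^ 3 * (2 : ℝ) ^ ((3 - ((n + 3 - j : ℕ) : ℝ)) * (s₁ + s₂)) *
        (u n * (2 : ℝ) ^ (((n : ℝ) - 1) * s₁) * A n * ((2 : ℝ) ^ (δ + |s₂|) *
          neighbourSum (fun m => v m * (2 : ℝ) ^ (((m : ℝ) - 1) * s₂) * B m) n)) := by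
      gcongr
    _ = _ := by ring

/-- The remainder estimate with the weight split as a product of two weights, the second of which
varies slowly. -/
theorem besovW_lpRemainder_le {δ s₁ s₂ : ℝ} (hδ : 0 < δ)
    {p p₁ p₂ r r₁ r₂ : ℝ≥0∞} (hp : 1 ≤ p) (hp₂ : 1 ≤ p₂) (hr : 1 ≤ r)
    (hr₂ : 1 ≤ r₂) [ENNReal.HolderTriple p₁ p₂ p] [ENNReal.HolderTriple r₁ r₂ r]
    (P : LPCutoff) {K : ℝ≥0} (hK : ∀ n, eLpNorm (lpKernel P n) 1 volume ≤ K)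
    {ω u v : ℕ → ℝ} (hω : AFweight δ ω) (huv : ∀ n, ω n = u n * v n) (hu : ∀ n, 0 ≤ u n)
    (hv : ∀ n, 0 ≤ v n) (hv1 : ∀ n, v n ≤ v (n + 1)) (hv2 : ∀ n, v (n + 1) ≤ (2 : ℝ) ^ δ * v n)
    (f g : SchwartzMap E3 ℂ) :
    besovW P ω (s₁ + s₂) p r (lpRemainder P f g) ≤
      (∑' m : ℕ, ENNReal.ofReal (remainderKernel K δ s₁ s₂ m)) * 3 *
        besovW P u s₁ p₁ r₁ f * besovW P v s₂ p₂ r₂ g := by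
  have htop (q : ℝ≥0∞) (n : ℕ) (h : SchwartzMap E3 ℂ) :
      ENNReal.ofReal (eLpNorm (LPblock P n h) q volume).toReal = eLpNorm (LPblock P n h) q volume := by
    refine ENNReal.ofReal_toReal ?_
    rw [← coe_lpBlockS]
    exact ((lpBlockS P n h).memLp q volume).eLpNorm_ne_top
  obtain ⟨A, hA⟩ : ∃ A : ℕ → ℝ,
      A = fun n => (eLpNorm (LPblock P n f) p₁ volume).toReal := ⟨_, rfl⟩
  obtain ⟨B, hB⟩ : ∃ B : ℕ → ℝ,
      B = fun n => (eLpNorm (LPblock P n g) p₂ volume).toReal := ⟨_, rfl⟩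
  have hA0 (n : ℕ) : 0 ≤ A n := hA ▸ ENNReal.toReal_nonneg
  have hB0 (n : ℕ) : 0 ≤ B n := hB ▸ ENNReal.toReal_nonneg
  have hAn (n : ℕ) : eLpNorm (LPblock P n f) p₁ volume = ENNReal.ofReal (A n) := by
    rw [hA, htop]
  have hBn (n : ℕ) : eLpNorm (LPblock P n g) p₂ volume = ENNReal.ofReal (B n) := by
    rw [hB, htop]
  obtain ⟨a, ha⟩ : ∃ a : ℕ → ℝ,
      a = fun n => u n * (2 : ℝ) ^ (((n : ℝ) - 1) * s₁) * A n := ⟨_, rfl⟩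
  obtain ⟨b, hb⟩ : ∃ b : ℕ → ℝ,
      b = fun n => v n * (2 : ℝ) ^ (((n : ℝ) - 1) * s₂) * B n := ⟨_, rfl⟩
  have ha0 (n : ℕ) : 0 ≤ a n := by
    have := hu n
    have := hA0 n
    rw [ha]
    positivity
  have hb0 (n : ℕ) : 0 ≤ b n := by
    have := hv n
    have := hB0 n
    rw [hb]
    positivity
  have hblock (j : ℕ) : ‖ω j * (2 : ℝ) ^ (((j : ℝ) - 1) * (s₁ + s₂)) *
      (eLpNorm (LPblock P j (lpRemainder P f g)) p volume).toReal‖ₑ ≤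
      ‖∑' n, if j ≤ n + 3 then ENNReal.ofReal (remainderKernel K δ s₁ s₂ (n + 3 - j)) *
        ‖a n * neighbourSum b n‖ₑ else 0‖ₑ := by
    have hωj : 0 ≤ ω j * (2 : ℝ) ^ (((j : ℝ) - 1) * (s₁ + s₂)) :=
      mul_nonneg (zero_le_one.trans (hω j).1) (by positivity)
    rw [enorm_eq_self, Real.enorm_eq_ofReal (mul_nonneg hωj ENNReal.toReal_nonneg),
      ENNReal.ofReal_mul hωj]
    refine (mul_le_mul_right (ENNReal.ofReal_toReal_le.trans
      (eLpNorm_LPblock_lpRemainder_le P hK hp hp₂ (p₁ := p₁) f g j)) _).trans ?_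
    rw [← ENNReal.tsum_mul_left]
    refine ENNReal.tsum_le_tsum fun n => ?_
    by_cases hjn : j ≤ n + 3
    · rw [if_pos hjn, if_pos hjn]
      simp only [hAn, hBn]
      rw [← ofReal_neighbourSum hB0, ← ENNReal.ofReal_mul (hA0 n), ← ENNReal.ofReal_coe_nnreal,
        ← ENNReal.ofReal_mul K.coe_nonneg, ← ENNReal.ofReal_mul hωj,
        Real.enorm_eq_ofReal (mul_nonneg (ha0 n) (neighbourSum_nonneg hb0 n)),
        ← ENNReal.ofReal_mul (remainderKernel_nonneg K.coe_nonneg δ s₁ s₂ _), ha, hb]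
      exact ENNReal.ofReal_le_ofReal (weight_mul_le K.coe_nonneg hδ hω huv hu hv hv1 hv2 hA0 hB0 hjn)
    · rw [if_neg hjn, if_neg hjn, mul_zero]
  have hf : besovW P u s₁ p₁ r₁ f = eLpNorm a r₁ Measure.count := by
    rw [ha, hA, besovW]
  have hg : besovW P v s₂ p₂ r₂ g = eLpNorm b r₂ Measure.count := by
    rw [hb, hB, besovW]
  rw [hf, hg, besovW]
  calc _ ≤ (∑' m, ENNReal.ofReal (remainderKernel K δ s₁ s₂ m)) *
        eLpNorm (fun n => a n * neighbourSum b n) r Measure.count :=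
        (eLpNorm_mono_enorm hblock).trans (eLpNorm_tsum_shift_le hr
          (fun m => ENNReal.ofReal (remainderKernel K δ s₁ s₂ m)) fun n => a n * neighbourSum b n)
    _ ≤ (∑' m, ENNReal.ofReal (remainderKernel K δ s₁ s₂ m)) *
        (eLpNorm a r₁ Measure.count * (3 * eLpNorm b r₂ Measure.count)) :=
        mul_le_mul_right ((eLpNorm_count_mul_le r r₁ r₂ a (neighbourSum b)).trans
          (mul_le_mul_right (eLpNorm_neighbourSum_le hr₂ b) _)) _
    _ = _ := by
      rw [mul_left_comm (eLpNorm a _ _) 3, ← mul_assoc, ← mul_assoc]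

theorem tsum_ofReal_remainderKernel_ne_top (K δ : ℝ) {s₁ s₂ : ℝ} (hs : 0 < s₁ + s₂) :
    ∑' m : ℕ, ENNReal.ofReal (remainderKernel K δ s₁ s₂ m) ≠ ∞ := by
  refine Summable.tsum_ofReal_ne_top ?_
  unfold remainderKernel
  have hq : (2 : ℝ) ^ (-(s₁ + s₂)) < 1 :=
    Real.rpow_lt_one_of_one_lt_of_neg one_lt_two (neg_neg_of_pos hs)
  refine (((summable_geometric_of_lt_one (by positivity) hq).mul_left
    ((2 : ℝ) ^ (3 * (s₁ + s₂)))).mul_left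
      (K * ((2 : ℝ) ^ δ) ^ 3 * (2 : ℝ) ^ (δ + |s₂|))).congr fun m => ?_
  congr 1
  rw [← Real.rpow_natCast, ← Real.rpow_mul two_pos.le, ← Real.rpow_add two_pos]
  congr 1
  ring

/-- Lemma 2.5, remainder estimates: for `s₁ + s₂ > 0`, `1/p = 1/p₁ + 1/p₂`,
`1/r = 1/r₁ + 1/r₂`,
`∥R(f,g)∥_{B^{s₁+s₂}_{p,r}(ω)} ≤ C ∥f∥_{B^{s₁}_{p₁,r₁}} ∥g∥_{B^{s₂}_{p₂,r₂}(ω)}` and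
`∥R(f,g)∥_{B^{s₁+s₂}_{p,r}(ω)} ≤ C ∥f∥_{B^{s₁}_{p₁,r₁}(ω)} ∥g∥_{B^{s₂}_{p₂,r₂}}`,
with `C` independent of the weight `ω ∈ AF(δ)`. -/
theorem remainder_weighted (δ s₁ s₂ : ℝ) (hδ : 0 < δ) (hs : 0 < s₁ + s₂)
    (p p₁ p₂ r r₁ r₂ : ℝ≥0∞)
    (hp : 1 ≤ p) (hp₁ : 1 ≤ p₁) (hp₂ : 1 ≤ p₂)
    (hr : 1 ≤ r) (hr₁ : 1 ≤ r₁) (hr₂ : 1 ≤ r₂)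
    (hpEq : p⁻¹ = p₁⁻¹ + p₂⁻¹) (hrEq : r⁻¹ = r₁⁻¹ + r₂⁻¹) (P : LPCutoff) :
    ∃ C : ℝ, 0 < C ∧ ∀ ω : ℕ → ℝ, AFweight δ ω → ∀ f g : SchwartzMap E3 ℂ,
      besovW P ω (s₁ + s₂) p r (lpRemainder P ⇑f ⇑g) ≤
          ENNReal.ofReal C * besov P s₁ p₁ r₁ ⇑f * besovW P ω s₂ p₂ r₂ ⇑g ∧
      besovW P ω (s₁ + s₂) p r (lpRemainder P ⇑f ⇑g) ≤
          ENNReal.ofReal C * besovW P ω s₁ p₁ r₁ ⇑f * besov P s₂ p₂ r₂ ⇑g := by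
  obtain ⟨K, hK⟩ := exists_eLpNorm_lpKernel_le P
  have : ENNReal.HolderTriple p₁ p₂ p := ⟨hpEq.symm⟩
  have : ENNReal.HolderTriple r₁ r₂ r := ⟨hrEq.symm⟩
  set D : ℝ≥0∞ := (∑' m : ℕ, ENNReal.ofReal (remainderKernel K δ s₁ s₂ m)) * 3 with hD
  have hDtop : D ≠ ∞ := ENNReal.mul_ne_top (tsum_ofReal_remainderKernel_ne_top _ _ hs) (by simp)
  have hDC : D ≤ ENNReal.ofReal (D.toReal + 1) := by
    rw [← ENNReal.ofReal_toReal hDtop, ENNReal.toReal_ofReal ENNReal.toReal_nonneg]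
    exact ENNReal.ofReal_le_ofReal (by linarith)
  have h2δ : (1 : ℝ) ≤ 2 ^ δ := Real.one_le_rpow one_le_two hδ.le
  refine ⟨D.toReal + 1, by positivity, fun ω hω f g => ⟨?_, ?_⟩⟩
  · refine (besovW_lpRemainder_le hδ hp hp₂ hr hr₂ (r₁ := r₁) (p₁ := p₁) P hK hω
      (u := fun _ => 1) (v := ω) (fun n => (one_mul _).symm) (fun _ => zero_le_one)
      (fun n => zero_le_one.trans (hω n).1) (fun n => (hω n).2.1) (fun n => (hω n).2.2) f g).trans ?_
    unfold besov
    gcongr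
  · refine (besovW_lpRemainder_le hδ hp hp₂ hr hr₂ (r₁ := r₁) (p₁ := p₁) P hK hω
      (u := ω) (v := fun _ => 1) (fun n => (mul_one _).symm)
      (fun n => zero_le_one.trans (hω n).1) (fun _ => zero_le_one) (fun _ => le_rfl)
      (fun _ => by simpa using h2δ) f g).trans ?_
    unfold besov
    gcongr

end
end
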